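/- arXiv:1807.03545 — 11 statements merged into one kernel-verified Lean document; each statement's English description precedes it below -/
import Mathlib

section
/- For every fixed s ∈ [0, 1], the function z ↦ ( log((1 − s) + s/z) + s·log z ) / (1 − z)² is decreasing in z on (0, ∞) \ {1}: for all 0 < z₁ < z₂ with z₁ ≠ 1 and z₂ ≠ 1, ( log((1 − s) + s/z₁) + s·log z₁ ) / (1 − z₁)² ≥ ( log((1 − s) + s/z₂) + s·log z₂ ) / (1 − z₂)². -/
open Real Set

/-- Along the segment `u = 1 + t (z - 1)`, the function `u ↦ log ((1 - s) u + s) - (1 - s) log u`,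
divided by `(1 - z) ^ 2`, has derivative `s (1 - s) t / (u ((1 - s) u + s))`. -/
lemma hasDerivAt_log_segment_div_sq {s z t : ℝ} (hz : z ≠ 1)
    (hu : 0 < 1 + t * (z - 1)) (hv : 0 < (1 - s) * (1 + t * (z - 1)) + s) :
    HasDerivAt
      (fun t : ℝ => (log ((1 - s) * (1 + t * (z - 1)) + s)
        - (1 - s) * log (1 + t * (z - 1))) / (1 - z) ^ 2)
      (s * (1 - s) * t / ((1 + t * (z - 1)) * ((1 - s) * (1 + t * (z - 1)) + s))) t := by
  have hU : HasDerivAt (fun t : ℝ => 1 + t * (z - 1)) (z - 1) t := by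
    simpa using ((hasDerivAt_id t).mul_const (z - 1)).const_add 1
  have hV := (hU.const_mul (1 - s)).add_const s
  have h := ((hV.log hv.ne').sub ((hU.log hu.ne').const_mul (1 - s))).div_const ((1 - z) ^ 2)
  have hz' : 1 - z ≠ 0 := sub_ne_zero.mpr hz.symm
  refine h.congr_deriv ?_
  have hu' := hu.ne'
  have hv' := hv.ne'
  rw [div_sub' hv', div_div, div_eq_div_iff (by positivity) (by positivity)]
  generalize hx : 1 + t * (z - 1) = u at *
  field_simp
  rw [← hx]
  ring

lemma log_one_sub_add_div_add_mul_log {s z : ℝ} (hz : 0 < z) (hv : 0 < (1 - s) * z + s) :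
    log ((1 - s) + s / z) + s * log z = log ((1 - s) * z + s) - (1 - s) * log z := by
  have h : (1 - s) + s / z = ((1 - s) * z + s) / z := by field_simp
  rw [h, log_div hv.ne' hz.ne']
  ring

/-- for fixed `s ∈ [0, 1]`, the function
`z ↦ (log((1 − s) + s/z) + s·log z) / (1 − z)²` is decreasing on `(0, ∞) \ {1}`. -/
theorem barycentre_lower_bound_ratio_decreasing
    (s : ℝ) (hs : s ∈ Icc (0:ℝ) 1) (z₁ z₂ : ℝ)
    (hz₁pos : 0 < z₁) (h12 : z₁ < z₂) (hz₁ : z₁ ≠ 1) (hz₂ : z₂ ≠ 1) :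
    (Real.log ((1 - s) + s / z₁) + s * Real.log z₁) / (1 - z₁) ^ 2
      ≥ (Real.log ((1 - s) + s / z₂) + s * Real.log z₂) / (1 - z₂) ^ 2 := by
  obtain ⟨hs0, hs1⟩ := hs
  have hs1' : 0 ≤ 1 - s := sub_nonneg.mpr hs1
  have hz₂pos : 0 < z₂ := hz₁pos.trans h12
  have hu {z t : ℝ} (hz : 0 < z) (ht : t ∈ Icc (0:ℝ) 1) : 0 < 1 + t * (z - 1) := by
    rcases ht.2.eq_or_lt with rfl | h
    · linarith
    · nlinarith [mul_nonneg ht.1 hz.le]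
  have hv {u : ℝ} (h : 0 < u) : 0 < (1 - s) * u + s := by
    rcases hs0.eq_or_lt with rfl | h0
    · simpa using h
    · positivity
  have hderiv (t : ℝ) (ht : t ∈ Icc (0:ℝ) 1) :=
    (hasDerivAt_log_segment_div_sq hz₁ (hu hz₁pos ht) (hv (hu hz₁pos ht))).sub
      (hasDerivAt_log_segment_div_sq hz₂ (hu hz₂pos ht) (hv (hu hz₂pos ht)))
  have hmono := monotoneOn_of_hasDerivWithinAt_nonneg (convex_Icc (0:ℝ) 1)
    (fun t ht => (hderiv t ht).continuousAt.continuousWithinAt)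
    (fun t ht => (hderiv t (interior_subset ht)).hasDerivWithinAt)
    (fun t ht => by
      have ht' : t ∈ Icc (0:ℝ) 1 := interior_subset ht
      have ht0 := ht'.1
      have h₁ := hu hz₁pos ht'
      have h₂ := hu hz₂pos ht'
      have hv₁ := hv h₁
      have hle : 1 + t * (z₁ - 1) ≤ 1 + t * (z₂ - 1) := by gcongr
      rw [sub_nonneg]
      gcongr)
  have h := hmono (left_mem_Icc.mpr zero_le_one) (right_mem_Icc.mpr zero_le_one) zero_le_one
  rw [ge_iff_le, log_one_sub_add_div_add_mul_log hz₁pos (hv hz₁pos),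
    log_one_sub_add_div_add_mul_log hz₂pos (hv hz₂pos)]
  simpa using h
end

section
/- For every z ≥ 1 and every s ∈ [0, 1], log((1 − s) + s/z) + s·log z ≥ s·(1 − s)·(1/z − 1 + log z). -/
open Real Set

/-- The derivative of the gap between the two sides is `s² (1 - s) (x - 1)² / (x² ((1 - s) x + s))`. -/
lemma hasDerivAt_barycentre_gap {s x : ℝ} (hx : x ≠ 0) (hD : (1 - s) * x + s ≠ 0) :
    HasDerivAt (fun y : ℝ => Real.log ((1 - s) * y + s) - (1 - s) * Real.log y
        - s * (1 - s) * (y⁻¹ - 1 + Real.log y))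
      (s ^ 2 * (1 - s) * (x - 1) ^ 2 / (x ^ 2 * ((1 - s) * x + s))) x := by
  have hlin : HasDerivAt (fun y : ℝ => (1 - s) * y + s) (1 - s) x := by
    simpa using ((hasDerivAt_id x).const_mul (1 - s)).add_const s
  have hlog := Real.hasDerivAt_log hx
  have h := ((hlin.log hD).sub (hlog.const_mul (1 - s))).sub
    ((((hasDerivAt_inv hx).sub_const 1).add hlog).const_mul (s * (1 - s)))
  refine h.congr_deriv ?_
  field_simp
  ring

/-- for all `z ≥ 1` and `s ∈ [0, 1]`,
`log((1 − s) + s/z) + s·log z ≥ s·(1 − s)·(1/z − 1 + log z)`. -/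
theorem barycentre_lower_bound_ratio
    (z : ℝ) (hz : 1 ≤ z) (s : ℝ) (hs : s ∈ Icc (0:ℝ) 1) :
    Real.log ((1 - s) + s / z) + s * Real.log z
      ≥ s * (1 - s) * (1 / z - 1 + Real.log z) := by
  have hs1 : 0 ≤ 1 - s := sub_nonneg.2 hs.2
  have hD : ∀ x : ℝ, 1 ≤ x → 0 < (1 - s) * x + s := fun x hx => by
    nlinarith [mul_nonneg hs1 (sub_nonneg.2 hx)]
  have hderiv : ∀ x : ℝ, 1 ≤ x → HasDerivAt _ _ x := fun x hx =>
    hasDerivAt_barycentre_gap (zero_lt_one.trans_le hx).ne' (hD x hx).ne'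
  have hmono := monotoneOn_of_hasDerivWithinAt_nonneg (convex_Ici (1 : ℝ))
    (fun x hx => (hderiv x hx).continuousAt.continuousWithinAt)
    (fun x hx => (hderiv x (interior_subset hx)).hasDerivWithinAt)
    (fun x hx => div_nonneg (mul_nonneg (mul_nonneg (sq_nonneg s) hs1) (sq_nonneg (x - 1)))
      (mul_nonneg (sq_nonneg x) (hD x (interior_subset hx)).le))
  have hgap := hmono (mem_Ici.2 le_rfl) (mem_Ici.2 hz) hz
  have hz0 : z ≠ 0 := (zero_lt_one.trans_le hz).ne'
  have hratio : (1 - s) + s / z = ((1 - s) * z + s) / z := by field_simp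
  rw [hratio, Real.log_div (hD z hz).ne' hz0, one_div]
  simp only [mul_one, sub_add_cancel, Real.log_one, inv_one, sub_self, add_zero, mul_zero] at hgap
  linarith
end

section
/- For every real R > 1, 2·(1/R + log R − 1)·(R − 1)^{−2} ≥ R^{−2}; equivalently, 2·R²·(1/R + log R − 1) ≥ (R − 1)² for all R ≥ 1. -/
open Real

theorem sq_sub_one_le_two_mul_sq_mul_log {R : ℝ} (hR : 1 ≤ R) :
    (R - 1) ^ 2 ≤ 2 * R ^ 2 * (1 / R + Real.log R - 1) := by
  have hR0 : 0 < R := by linarith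
  have hlog : 2 * (R - 1) / (R + 1) ≤ Real.log R := by
    have h := Real.le_log_one_add_of_nonneg (sub_nonneg.2 hR)
    rwa [add_sub_cancel, show R - 1 + 2 = R + 1 by ring] at h
  calc (R - 1) ^ 2 ≤ (R - 1) ^ 2 * (2 * R / (R + 1)) := by
        apply le_mul_of_one_le_right (sq_nonneg _)
        rw [one_le_div (by linarith)]
        linarith
    _ = 2 * R ^ 2 * (1 / R + 2 * (R - 1) / (R + 1) - 1) := by
        field_simp
        ring
    _ ≤ 2 * R ^ 2 * (1 / R + Real.log R - 1) := by gcongr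

/-- for every `R > 1`, `2·(1/R + log R − 1)·(R − 1)⁻² ≥ R⁻²`; equivalently,
`2·R²·(1/R + log R − 1) ≥ (R − 1)²` for all `R ≥ 1`. -/
theorem rate_comparison :
    (∀ R : ℝ, 1 < R →
      2 * (1 / R + Real.log R - 1) * ((R - 1) ^ 2)⁻¹ ≥ (R ^ 2)⁻¹) ∧
    (∀ R : ℝ, 1 ≤ R →
      2 * R ^ 2 * (1 / R + Real.log R - 1) ≥ (R - 1) ^ 2) := by
  refine ⟨fun R hR => ?_, fun R hR => sq_sub_one_le_two_mul_sq_mul_log hR⟩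
  have h := sq_sub_one_le_two_mul_sq_mul_log hR.le
  have hR0 : 0 < R ^ 2 := by positivity
  have hR1 : 0 < (R - 1) ^ 2 := pow_pos (sub_pos.2 hR) 2
  rw [ge_iff_le, ← div_eq_mul_inv, inv_eq_one_div, div_le_div_iff₀ hR0 hR1]
  linarith
end

section
/- Let L > 0, K ≥ 0 and R > 1, and define σ = ( 1 + (K/(2L))·(R − 1)²/(1/R + log R − 1) )^{−1}. Then for every s ∈ [0, σ] and every r ∈ (0, R], L·( log(1 − s + s/r) + s·log r ) ≥ (s²·K/2)·(1 − r)². -/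
open Real Set

/-- The function `x ↦ 1/x + log x - 1` dominates half the square of `1 - 1/x` on `[1, ∞)`. -/
lemma sq_one_sub_inv_le_two_mul {x : ℝ} (hx : 1 ≤ x) :
    (1 - 1 / x) ^ 2 ≤ 2 * (1 / x + Real.log x - 1) := by
  have key : MonotoneOn (fun y : ℝ => 2 * (y⁻¹ + Real.log y - 1) - (1 - y⁻¹) ^ 2) (Icc 1 x) := by
    have hd : ∀ y : ℝ, 1 ≤ y →
        HasDerivAt (fun y : ℝ => 2 * (y⁻¹ + Real.log y - 1) - (1 - y⁻¹) ^ 2)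
          (2 * (y - 1) ^ 2 / y ^ 3) y := by
      intro y hy
      have hy0 : y ≠ 0 := by positivity
      refine HasDerivAt.congr_deriv (((((hasDerivAt_inv hy0).add (Real.hasDerivAt_log hy0)).sub_const 1).const_mul 2).sub
        (((hasDerivAt_inv hy0).const_sub 1).pow 2)) ?_
      simp only [Nat.cast_ofNat, Nat.add_one_sub_one, pow_one]
      field_simp
      ring
    refine monotoneOn_of_hasDerivWithinAt_nonneg (convex_Icc 1 x)
      (fun y hy => (hd y hy.1).continuousAt.continuousWithinAt)
      (fun y hy => (hd y (interior_subset hy).1).hasDerivWithinAt) fun y hy => ?_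
    have : 1 ≤ y := (interior_subset hy).1
    positivity
  have := key (left_mem_Icc.2 hx) (right_mem_Icc.2 hx) hx
  norm_num at this ⊢
  linarith

lemma inv_add_log_sub_one_le_sq {x : ℝ} (hx : 1 ≤ x) :
    1 / x + Real.log x - 1 ≤ (x - 1) ^ 2 / 2 := by
  have key : MonotoneOn (fun y : ℝ => (y - 1) ^ 2 / 2 - (y⁻¹ + Real.log y - 1)) (Icc 1 x) := by
    have hd : ∀ y : ℝ, 1 ≤ y →
        HasDerivAt (fun y : ℝ => (y - 1) ^ 2 / 2 - (y⁻¹ + Real.log y - 1))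
          ((y - 1) ^ 2 * (y + 1) / y ^ 2) y := by
      intro y hy
      have hy0 : y ≠ 0 := by positivity
      refine HasDerivAt.congr_deriv (((((hasDerivAt_id y).sub_const 1).pow 2).div_const 2).sub
        (((hasDerivAt_inv hy0).add (Real.hasDerivAt_log hy0)).sub_const 1)) ?_
      simp only [id]
      field_simp
      ring
    refine monotoneOn_of_hasDerivWithinAt_nonneg (convex_Icc 1 x)
      (fun y hy => (hd y hy.1).continuousAt.continuousWithinAt)
      (fun y hy => (hd y (interior_subset hy).1).hasDerivWithinAt) fun y hy => ?_
    have : 1 ≤ y := (interior_subset hy).1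
    positivity
  have := key (left_mem_Icc.2 hx) (right_mem_Icc.2 hx) hx
  norm_num at this ⊢
  linarith

/-- The ratio `(1/x + log x - 1) / (x - 1)²` is antitone on `(1, ∞)`. -/
lemma inv_add_log_sub_one_div_sq_anti {r R : ℝ} (hr : 1 < r) (hrR : r ≤ R) :
    (1 / R + Real.log R - 1) / (R - 1) ^ 2 ≤ (1 / r + Real.log r - 1) / (r - 1) ^ 2 := by
  have key : AntitoneOn (fun y : ℝ => (y⁻¹ + Real.log y - 1) / (y - 1) ^ 2) (Icc r R) := by
    have hd : ∀ y : ℝ, 1 < y →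
        HasDerivAt (fun y : ℝ => (y⁻¹ + Real.log y - 1) / (y - 1) ^ 2)
          (((1 - 1 / y) ^ 2 - 2 * (1 / y + Real.log y - 1)) / (y - 1) ^ 3) y := by
      intro y hy
      have hy0 : y ≠ 0 := by positivity
      have hy1 : y - 1 ≠ 0 := by linarith
      refine HasDerivAt.congr_deriv ((((hasDerivAt_inv hy0).add (Real.hasDerivAt_log hy0)).sub_const 1).div
        (((hasDerivAt_id y).sub_const 1).pow 2) (pow_ne_zero 2 hy1)) ?_
      simp
      field_simp
      ring
    refine antitoneOn_of_hasDerivWithinAt_nonpos (convex_Icc r R)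
      (fun y hy => (hd y (hr.trans_le hy.1)).continuousAt.continuousWithinAt)
      (fun y hy => (hd y (hr.trans_le (interior_subset hy).1)).hasDerivWithinAt) fun y hy => ?_
    have hy : 1 < y := hr.trans_le (interior_subset hy).1
    have hy1 : 0 < y - 1 := by linarith
    exact div_nonpos_of_nonpos_of_nonneg
      (by linarith [sq_one_sub_inv_le_two_mul hy.le]) (by positivity)
  simpa using key (left_mem_Icc.2 hrR) (right_mem_Icc.2 hrR) hrR

lemma mul_sq_le_log_of_le_one {s r : ℝ} (hs0 : 0 ≤ s) (hs1 : s ≤ 1) (hr0 : 0 < r) (hr1 : r ≤ 1) :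
    s * (1 - s) * ((1 - r) ^ 2 / 2) ≤ Real.log (1 - s + s / r) + s * Real.log r := by
  have hc : ConcaveOn ℝ (Ioc (0 : ℝ) 1) (fun x => Real.log x + x ^ 2 / 2) := by
    have hd : ∀ x : ℝ, 0 < x → HasDerivAt (fun x => Real.log x + x ^ 2 / 2) (x⁻¹ + x) x := by
      intro x hx
      refine HasDerivAt.congr_deriv ((Real.hasDerivAt_log hx.ne').add (((hasDerivAt_id x).pow 2).div_const 2)) ?_
      simp
    refine AntitoneOn.concaveOn_of_deriv (convex_Ioc 0 1)
      (fun x hx => (hd x hx.1).continuousAt.continuousWithinAt)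
      (fun x hx => (hd x (interior_subset hx).1).differentiableAt.differentiableWithinAt) ?_
    intro x hx y hy hxy
    obtain ⟨hx0, hx1⟩ := interior_subset hx
    obtain ⟨hy0, hy1⟩ := interior_subset hy
    rw [(hd x hx0).deriv, (hd y hy0).deriv]
    have : x⁻¹ + x - (y⁻¹ + y) = (y - x) * (1 - x * y) / (x * y) := by
      field_simp
      ring
    have : 0 ≤ (y - x) * (1 - x * y) / (x * y) :=
      div_nonneg (mul_nonneg (by linarith) (by nlinarith)) (by positivity)
    linarith
  have h := hc.2 (show r ∈ Ioc (0 : ℝ) 1 from ⟨hr0, hr1⟩) (show (1 : ℝ) ∈ Ioc (0 : ℝ) 1 by simp)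
    (sub_nonneg.2 hs1) hs0 (by ring)
  simp only [smul_eq_mul, Real.log_one, mul_one] at h
  have hpos : 0 < (1 - s) * r + s := by
    rcases hs0.eq_or_lt with rfl | h0
    · simpa
    · have := mul_nonneg (sub_nonneg.2 hs1) hr0.le
      linarith
  have hlog : Real.log (1 - s + s / r) = Real.log ((1 - s) * r + s) - Real.log r := by
    rw [← Real.log_div hpos.ne' hr0.ne']
    congr 1
    field_simp
  rw [hlog]
  linear_combination h

lemma mul_inv_add_log_sub_one_le_log {s r : ℝ} (hs0 : 0 ≤ s) (hs1 : s ≤ 1) (hr : 1 < r) :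
    s * (1 - s) * (1 / r + Real.log r - 1) ≤ Real.log (1 - s + s / r) + s * Real.log r := by
  have hr0 : 0 < r := by linarith
  have hg : 0 ≤ 1 / r + Real.log r - 1 := by
    linarith [sq_one_sub_inv_le_two_mul hr.le, sq_nonneg (1 - 1 / r)]
  set g := 1 / r + Real.log r - 1 with hgdef
  set a := 1 - 1 / r with hadef
  have ha : 0 < a := by
    have : 1 / r < 1 := (div_lt_one hr0).2 hr
    linarith
  have ha1 : a < 1 := by
    have : 0 < 1 / r := by positivity
    linarith
  have hlogr : Real.log r = a + g := by rw [hgdef, hadef]; ring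
  let h : ℝ → ℝ := fun t => Real.log (1 - t * a) + t * (a + g) - t * (1 - t) * g
  have hpos : ∀ t, t ≤ 1 → 0 < 1 - t * a := fun t ht => by nlinarith
  have hd : ∀ t, t ≤ 1 →
      HasDerivAt h (t * (2 * g - a ^ 2 - 2 * t * g * a) / (1 - t * a)) t := by
    intro t ht
    have hp := (hpos t ht).ne'
    have hid := hasDerivAt_id t
    refine HasDerivAt.congr_deriv (((((hid.mul_const a).const_sub 1).log hp).add (hid.mul_const (a + g))).sub
      ((hid.mul (hid.const_sub 1)).mul_const g)) ?_
    have hp' : 1 - a * t ≠ 0 := by rwa [mul_comm]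
    simp only [id]
    field_simp
    ring
  have hmain : 0 ≤ h s := by
    rcases le_total 0 (2 * g - a ^ 2 - 2 * s * g * a) with hq | hq
    · have hm : MonotoneOn h (Icc 0 s) := by
        refine monotoneOn_of_hasDerivWithinAt_nonneg (convex_Icc 0 s)
          (fun t ht => (hd t (ht.2.trans hs1)).continuousAt.continuousWithinAt)
          (fun t ht => (hd t ((interior_subset ht).2.trans hs1)).hasDerivWithinAt) fun t ht => ?_
        obtain ⟨ht0, hts⟩ := interior_subset ht
        have := mul_nonneg (sub_nonneg.2 hts) (mul_nonneg hg ha.le)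
        exact div_nonneg (mul_nonneg ht0 (by linarith)) (hpos t (hts.trans hs1)).le
      simpa [h] using hm (left_mem_Icc.2 hs0) (right_mem_Icc.2 hs0) hs0
    · have hm : AntitoneOn h (Icc s 1) := by
        refine antitoneOn_of_hasDerivWithinAt_nonpos (convex_Icc s 1)
          (fun t ht => (hd t ht.2).continuousAt.continuousWithinAt)
          (fun t ht => (hd t (interior_subset ht).2).hasDerivWithinAt) fun t ht => ?_
        obtain ⟨hts, ht1⟩ := interior_subset ht
        have := mul_nonneg (sub_nonneg.2 hts) (mul_nonneg hg ha.le)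
        exact div_nonpos_of_nonpos_of_nonneg
          (mul_nonpos_of_nonneg_of_nonpos (hs0.trans hts) (by linarith)) (hpos t ht1).le
      have h1 : h 1 = 0 := by
        simp only [h, one_mul, sub_self, mul_zero, zero_mul, sub_zero]
        rw [← hlogr, hadef, sub_sub_cancel, one_div, Real.log_inv]
        ring
      exact h1 ▸ hm (left_mem_Icc.2 hs1) (right_mem_Icc.2 hs1) hs1
  have harg : 1 - s + s / r = 1 - s * a := by rw [hadef]; ring
  rw [harg, hlogr]
  linarith [show h s = Real.log (1 - s * a) + s * (a + g) - s * (1 - s) * g from rfl]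

/-- with `L > 0`, `K ≥ 0`, `R > 1` and
`σ = (1 + (K/(2L))·(R − 1)²/(1/R + log R − 1))⁻¹`, for every `s ∈ [0, σ]` and
`r ∈ (0, R]` one has `L·(log(1 − s + s/r) + s·log r) ≥ (s²·K/2)·(1 − r)²`. -/
theorem sdca_convergence_condition
    (L K R : ℝ) (hL : 0 < L) (hK : 0 ≤ K) (hR : 1 < R)
    (σ : ℝ) (hσ : σ = (1 + K / (2 * L) * ((R - 1) ^ 2 / (1 / R + Real.log R - 1)))⁻¹)
    (s : ℝ) (hs : s ∈ Icc 0 σ) (r : ℝ) (hr : r ∈ Ioc (0:ℝ) R) :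
    L * (Real.log (1 - s + s / r) + s * Real.log r) ≥ s ^ 2 * K / 2 * (1 - r) ^ 2 := by
  obtain ⟨hs0, hsσ⟩ := hs
  obtain ⟨hr0, hrR⟩ := hr
  have hR1 : 0 < R - 1 := by linarith
  have hg : 0 < 1 / R + Real.log R - 1 := by
    have : 0 < 1 - 1 / R := sub_pos.2 ((div_lt_one (by linarith)).2 hR)
    linarith [sq_one_sub_inv_le_two_mul hR.le, pow_pos this 2]
  set c := (1 / R + Real.log R - 1) / (R - 1) ^ 2 with hc
  have hc0 : 0 < c := by positivity
  have hσs : s * (1 + K / (2 * L) * c⁻¹) ≤ 1 := by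
    rw [hc, inv_div]
    rw [hσ] at hsσ
    exact (le_inv_mul_iff₀' (by positivity)).1 (by simpa using hsσ)
  have hstep : s * K / 2 ≤ L * (1 - s) * c := by
    have h := mul_le_mul_of_nonneg_right hσs (mul_pos hL hc0).le
    have : s * (1 + K / (2 * L) * c⁻¹) * (L * c) = s * L * c + s * K / 2 := by
      field_simp
    linarith
  have hs1 : s ≤ 1 := by
    have : 0 ≤ s * (K / (2 * L) * c⁻¹) := by positivity
    linarith
  have hss : 0 ≤ s * (1 - s) := mul_nonneg hs0 (sub_nonneg.2 hs1)
  have hf : s * (1 - s) * (c * (1 - r) ^ 2) ≤ Real.log (1 - s + s / r) + s * Real.log r := by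
    rcases le_or_gt r 1 with hr1 | hr1
    · refine le_trans (mul_le_mul_of_nonneg_left ?_ hss) (mul_sq_le_log_of_le_one hs0 hs1 hr0 hr1)
      have : c ≤ 1 / 2 := by
        rw [hc, div_le_iff₀ (by positivity)]
        linarith [inv_add_log_sub_one_le_sq hR.le]
      linarith [mul_le_mul_of_nonneg_right this (sq_nonneg (1 - r))]
    · refine le_trans (mul_le_mul_of_nonneg_left ?_ hss)
        (mul_inv_add_log_sub_one_le_log hs0 hs1 hr1)
      have hr2 : 0 < (r - 1) ^ 2 := pow_pos (sub_pos.2 hr1) 2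
      rw [sub_sq_comm, ← le_div_iff₀ hr2]
      exact inv_add_log_sub_one_div_sq_anti hr1 hrR
  have h1 := mul_le_mul_of_nonneg_left hf hL.le
  have h2 := mul_le_mul_of_nonneg_right hstep (mul_nonneg hs0 (sq_nonneg (1 - r)))
  linarith
end

section
/- Assume the polytope Π(X) is nonempty, each f_i is convex and differentiable on (0, ∞) with lim_{t→0} f_i(t) = +∞, and g is strongly convex. Then strong duality holds: the minimum of P over Π(X) is attained at some w* ∈ Π(X), the maximum of D over (−D_{f*})^n is attained at some α*, P(w*) = D(α*), and the Karush–Kuhn–Tucker conditions relate the two optima: for every i ∈ {1, …, n}, α_i* = −f_i'(w*ᵀx_i), and w* = ∇g*((1/(λn))·∑_{i=1}^n α_i* x_i − ψ/λ). -/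
open Real Set Finset
open scoped RealInnerProductSpace

/-- The Fenchel conjugate of `f : D → ℝ`, `D ⊆ ℝ`: `f*(v) = sup_{u ∈ D} (u·v − f(u))`. -/
noncomputable def fenchel (D : Set ℝ) (f : ℝ → ℝ) (v : ℝ) : ℝ :=
  sSup ((fun u => u * v - f u) '' D)

/-- The domain of the Fenchel conjugate. -/
def fenchelDom (D : Set ℝ) (f : ℝ → ℝ) : Set ℝ :=
  {v | ((fun u => u * v - f u) '' D).Nonempty ∧ BddAbove ((fun u => u * v - f u) '' D)}

/-- The Fenchel conjugate of `g : ℝ^d → ℝ`: `g*(v) = sup_u (⟪u, v⟫ − g(u))`. -/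
noncomputable def fenchelE {d : ℕ} (g : EuclideanSpace ℝ (Fin d) → ℝ)
    (v : EuclideanSpace ℝ (Fin d)) : ℝ :=
  sSup (Set.range fun u => ⟪u, v⟫ - g u)

/-- The tangent line of a convex function on `(0, ∞)` lies below its graph. -/
lemma ConvexOn.add_deriv_mul_sub_le {f : ℝ → ℝ} {a t s : ℝ} (hf : ConvexOn ℝ (Ioi 0) f)
    (ht : 0 < t) (hs : 0 < s) (hd : HasDerivAt f a t) : f t + a * (s - t) ≤ f s := by
  rcases lt_trichotomy t s with h | h | h
  · have h1 := hf.le_slope_of_hasDerivAt (mem_Ioi.2 ht) (mem_Ioi.2 hs) h hd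
    rw [slope_def_field, le_div_iff₀ (sub_pos.2 h)] at h1
    linarith
  · subst h; simp
  · have h1 := hf.slope_le_of_hasDerivAt (mem_Ioi.2 hs) (mem_Ioi.2 ht) h hd
    rw [slope_def_field, div_le_iff₀ (sub_pos.2 h)] at h1
    linarith

/-- The Fenchel conjugate of a convex function is attained where the derivative matches. -/
lemma isGreatest_fenchel_of_hasDerivAt {f : ℝ → ℝ} {a t : ℝ} (hf : ConvexOn ℝ (Ioi 0) f)
    (ht : 0 < t) (hd : HasDerivAt f a t) :
    IsGreatest ((fun u => u * a - f u) '' Ioi 0) (t * a - f t) := by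
  refine ⟨⟨t, ht, rfl⟩, ?_⟩
  rintro _ ⟨s, hs, rfl⟩
  have := hf.add_deriv_mul_sub_le ht hs hd
  simp only
  linarith

/-- The Fenchel–Young inequality on `(0, ∞)`. -/
lemma mul_sub_le_fenchel {f : ℝ → ℝ} {v t : ℝ} (hv : v ∈ fenchelDom (Ioi 0) f) (ht : 0 < t) :
    t * v - f t ≤ fenchel (Ioi 0) f v :=
  le_csSup hv.2 ⟨t, ht, rfl⟩

section Conjugate

variable {d : ℕ} {g : EuclideanSpace ℝ (Fin d) → ℝ} {w θ : EuclideanSpace ℝ (Fin d)}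

/-- If `g` has a quadratic minorant at `w` with slope `θ`, then `g*` has a quadratic majorant at
`θ` with slope `w`. -/
lemma inner_sub_le_of_quadratic_minorant
    (h : ∀ u, ⟪θ, u - w⟫ + 1 / 2 * ‖u - w‖ ^ 2 ≤ g u - g w) (v u : EuclideanSpace ℝ (Fin d)) :
    ⟪u, v⟫ - g u ≤ ⟪w, v⟫ - g w + 1 / 2 * ‖v - θ‖ ^ 2 := by
  have h1 := h u
  have h2 : 0 ≤ ‖(u - w) - (v - θ)‖ ^ 2 := by positivity
  rw [norm_sub_sq_real] at h2
  have h3 : ⟪u - w, v - θ⟫ = ⟪u, v⟫ - ⟪w, v⟫ - ⟪θ, u - w⟫ := by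
    rw [real_inner_comm (u - w) θ]
    simp only [inner_sub_left, inner_sub_right]
  linarith

lemma bddAbove_of_quadratic_minorant
    (h : ∀ u, ⟪θ, u - w⟫ + 1 / 2 * ‖u - w‖ ^ 2 ≤ g u - g w) (v : EuclideanSpace ℝ (Fin d)) :
    BddAbove (Set.range fun u => ⟪u, v⟫ - g u) :=
  ⟨_, by rintro _ ⟨u, rfl⟩; exact inner_sub_le_of_quadratic_minorant h v u⟩

lemma inner_sub_le_fenchelE
    (h : ∀ u, ⟪θ, u - w⟫ + 1 / 2 * ‖u - w‖ ^ 2 ≤ g u - g w) (v u : EuclideanSpace ℝ (Fin d)) :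
    ⟪u, v⟫ - g u ≤ fenchelE g v :=
  le_csSup (bddAbove_of_quadratic_minorant h v) ⟨u, rfl⟩

lemma fenchelE_le_of_quadratic_minorant
    (h : ∀ u, ⟪θ, u - w⟫ + 1 / 2 * ‖u - w‖ ^ 2 ≤ g u - g w) (v : EuclideanSpace ℝ (Fin d)) :
    fenchelE g v ≤ ⟪w, v⟫ - g w + 1 / 2 * ‖v - θ‖ ^ 2 :=
  csSup_le (Set.range_nonempty _)
    (by rintro _ ⟨u, rfl⟩; exact inner_sub_le_of_quadratic_minorant h v u)

lemma fenchelE_eq_of_quadratic_minorant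
    (h : ∀ u, ⟪θ, u - w⟫ + 1 / 2 * ‖u - w‖ ^ 2 ≤ g u - g w) :
    fenchelE g θ = ⟪w, θ⟫ - g w :=
  le_antisymm (by simpa using fenchelE_le_of_quadratic_minorant h θ) (inner_sub_le_fenchelE h θ w)

lemma hasGradientAt_fenchelE_of_quadratic_minorant
    (h : ∀ u, ⟪θ, u - w⟫ + 1 / 2 * ‖u - w‖ ^ 2 ≤ g u - g w) :
    HasGradientAt (fenchelE g) w θ := by
  rw [hasGradientAt_iff_isLittleO]
  refine Asymptotics.IsBigO.trans_isLittleO (g := fun v => ‖v - θ‖ ^ 2) ?_ ?_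
  · refine Asymptotics.IsBigO.of_bound 1 (Filter.Eventually.of_forall fun v => ?_)
    have h1 := fenchelE_le_of_quadratic_minorant h v
    have h2 := inner_sub_le_fenchelE h v w
    rw [fenchelE_eq_of_quadratic_minorant h, inner_sub_right, Real.norm_eq_abs, Real.norm_eq_abs,
      abs_of_nonneg (by linarith), abs_of_nonneg (by positivity)]
    nlinarith [sq_nonneg ‖v - θ‖]
  · exact Asymptotics.isLittleO_pow_sub_sub θ one_lt_two

end Conjugate

section Minimization

variable {E : Type*} [NormedAddCommGroup E] [InnerProductSpace ℝ E]

/-- First-order optimality for the sum of a differentiable and a strongly convex function. -/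
lemma IsLocalMin.inner_add_le_sub [CompleteSpace E] {q G : E → ℝ} {w θ : E} {m : ℝ}
    (hmin : IsLocalMin (fun w => q w + G w) w) (hq : HasGradientAt q (-θ) w)
    (hG : StrongConvexOn univ m G) (u : E) :
    ⟪θ, u - w⟫ + m / 2 * ‖u - w‖ ^ 2 ≤ G u - G w := by
  have hline : HasDerivAt (fun t : ℝ => w + t • (u - w)) (u - w) 0 := by
    simpa using ((hasDerivAt_id (0 : ℝ)).smul_const (u - w)).const_add w
  have hder : HasDerivAt (fun t : ℝ => q (w + t • (u - w))) (-⟪θ, u - w⟫) 0 := by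
    have hq' : HasFDerivAt q (InnerProductSpace.toDual ℝ E (-θ)) (w + (0 : ℝ) • (u - w)) := by
      simpa using hq.hasFDerivAt
    simpa [Function.comp_def] using! hq'.comp_hasDerivAt 0 hline
  have hslope := (hasDerivAt_iff_tendsto_slope_zero.1 hder).mono_left
    (nhdsGT_le_nhdsNE (0 : ℝ))
  have hlim : Filter.Tendsto (fun t : ℝ => t⁻¹ • (q (w + (0 + t) • (u - w))
        - q (w + (0 : ℝ) • (u - w))) + (G u - G w - (1 - t) * (m / 2 * ‖u - w‖ ^ 2)))
      (nhdsWithin 0 (Ioi 0))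
      (nhds (-⟪θ, u - w⟫ + (G u - G w - (1 - 0) * (m / 2 * ‖u - w‖ ^ 2)))) := by
    refine hslope.add (Filter.Tendsto.mono_left ?_ nhdsWithin_le_nhds)
    exact Continuous.tendsto (by fun_prop) 0
  have hcont : Filter.Tendsto (fun t : ℝ => w + t • (u - w)) (nhdsWithin 0 (Ioi 0)) (nhds w) := by
    have := hline.continuousAt.tendsto
    simp only [zero_smul, add_zero] at this
    exact this.mono_left nhdsWithin_le_nhds
  have hnonneg := ge_of_tendsto hlim (b := 0) <| by
    filter_upwards [hcont.eventually hmin, Ioo_mem_nhdsGT one_pos] with t ht ht1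
    have hGt := hG.2 (mem_univ w) (mem_univ u) (sub_nonneg.2 ht1.2.le) ht1.1.le (by ring)
    have hpt : (1 - t) • w + t • u = w + t • (u - w) := by module
    rw [hpt, norm_sub_rev] at hGt
    simp only [smul_eq_mul, zero_smul, add_zero, zero_add] at hGt ⊢
    have ht0 := ht1.1
    have : 0 ≤ t⁻¹ * (q (w + t • (u - w)) - q w
        + t * (G u - G w - (1 - t) * (m / 2 * ‖u - w‖ ^ 2))) :=
      mul_nonneg (by positivity) (by linarith)
    rwa [mul_add, inv_mul_cancel_left₀ ht0.ne'] at this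
  linarith

/-- Sublevel sets of a strongly convex function on an open set are bounded. -/
lemma StrongConvexOn.exists_norm_sub_le [FiniteDimensional ℝ E] {s : Set E} {F : E → ℝ} {m : ℝ}
    (hF : StrongConvexOn s m F) (hm : 0 < m) (hs : IsOpen s) {w₀ : E} (hw₀ : w₀ ∈ s) :
    ∃ R, ∀ w ∈ s, F w ≤ F w₀ → ‖w - w₀‖ ≤ R := by
  have hcont : ContinuousOn F s :=
    (hF.convexOn fun r => by positivity).continuousOn hs
  obtain ⟨ρ, hρ, hball⟩ := Metric.nhds_basis_closedBall.mem_iff.1 (hs.mem_nhds hw₀)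
  obtain ⟨c, hc⟩ := ((isCompact_closedBall w₀ ρ).image_of_continuousOn
    (hcont.mono hball)).bddBelow
  refine ⟨ρ + 2 * (F w₀ - c) / (m * ρ), fun w hw hle => ?_⟩
  set r := ‖w - w₀‖ with hr
  have hc₀ : c ≤ F w₀ := hc ⟨w₀, Metric.mem_closedBall_self hρ.le, rfl⟩
  have hnonneg : 0 ≤ 2 * (F w₀ - c) / (m * ρ) := div_nonneg (by linarith) (by positivity)
  by_contra! hlt
  have hρr : ρ < r := by linarith
  have hr0 : 0 < r := hρ.trans hρr
  have hconv := hF.2 hw hw₀ (div_pos hρ hr0).le (sub_nonneg.2 ((div_le_one hr0).2 hρr.le))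
    (add_sub_cancel (ρ / r) 1)
  have hpt : (ρ / r) • w + (1 - ρ / r) • w₀ = w₀ + (ρ / r) • (w - w₀) := by module
  have hmem : w₀ + (ρ / r) • (w - w₀) ∈ Metric.closedBall w₀ ρ := by
    rw [mem_closedBall_iff_norm, add_sub_cancel_left, norm_smul, ← hr, Real.norm_eq_abs,
      abs_of_pos (by positivity), div_mul_cancel₀ _ hr0.ne']
  have hcle := hc ⟨_, hmem, rfl⟩
  rw [hpt, ← hr] at hconv
  simp only [smul_eq_mul] at hconv
  have hquad : ρ / r * (1 - ρ / r) * (m / 2 * r ^ 2) = m * ρ / 2 * (r - ρ) := by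
    field_simp
  have hmul : ρ / r * F w ≤ ρ / r * F w₀ := by gcongr
  have hfin : 2 * (F w₀ - c) / (m * ρ) < r - ρ := by linarith
  rw [div_lt_iff₀ (by positivity)] at hfin
  nlinarith

variable {ι : Type*} [Fintype ι] {x : ι → E} {f : ι → ℝ → ℝ}

lemma isOpen_setOf_forall_inner_pos (x : ι → E) : IsOpen {w : E | ∀ i, 0 < ⟪w, x i⟫} := by
  simp only [ofPred_forall]
  exact isOpen_iInter_of_finite fun i => isOpen_lt continuous_const (by fun_prop)

lemma convexOn_sum_comp_inner (hf : ∀ i, ConvexOn ℝ (Ioi 0) (f i)) (x : ι → E) :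
    ConvexOn ℝ {w : E | ∀ i, 0 < ⟪w, x i⟫} fun w => ∑ i, f i ⟪w, x i⟫ := by
  refine ⟨fun u hu v hv a b ha hb hab i => ?_, fun u hu v hv a b ha hb hab => ?_⟩
  · have := (convex_Ioi (0 : ℝ)) (hu i) (hv i) ha hb hab
    simpa [inner_add_left, real_inner_smul_left] using this
  · rw [smul_sum, smul_sum, ← sum_add_distrib]
    refine sum_le_sum fun i _ => ?_
    have := (hf i).2 (mem_Ioi.2 (hu i)) (mem_Ioi.2 (hv i)) ha hb hab
    simpa [inner_add_left, real_inner_smul_left] using this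

/-- A strongly convex objective with barrier terms `f i` attains its minimum on the open
polytope. -/
lemma exists_isMinOn_polytope [FiniteDimensional ℝ E] {f' : ι → ℝ → ℝ} {G : E → ℝ} {c m : ℝ}
    (hc : 0 < c) (hm : 0 < m) (hf : ∀ i, ConvexOn ℝ (Ioi 0) (f i))
    (hd : ∀ i, ∀ t, 0 < t → HasDerivAt (f i) (f' i t) t)
    (hlim : ∀ i, Filter.Tendsto (f i) (nhdsWithin 0 (Ioi 0)) Filter.atTop)
    (hG : StrongConvexOn univ m G) (hne : {w : E | ∀ i, 0 < ⟪w, x i⟫}.Nonempty) :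
    ∃ w ∈ {w : E | ∀ i, 0 < ⟪w, x i⟫},
      IsMinOn (fun w => c * ∑ i, f i ⟪w, x i⟫ + G w) {w : E | ∀ i, 0 < ⟪w, x i⟫} w := by
  set s := {w : E | ∀ i, 0 < ⟪w, x i⟫} with hs
  set F : E → ℝ := fun w => c * ∑ i, f i ⟪w, x i⟫ + G w with hFdef
  obtain ⟨w₀, hw₀⟩ := hne
  have hopen : IsOpen s := isOpen_setOf_forall_inner_pos x
  have hsum : ConvexOn ℝ s fun w => ∑ i, f i ⟪w, x i⟫ := convexOn_sum_comp_inner hf x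
  have hF : StrongConvexOn s m F := by
    have h1 : UniformConvexOn s 0 fun w => c * ∑ i, f i ⟪w, x i⟫ :=
      (hsum.smul hc.le).uniformConvexOn_zero
    have h2 : StrongConvexOn s m G := ⟨hsum.1, fun u _ v _ => hG.2 (mem_univ u) (mem_univ v)⟩
    have h3 := h1.add h2
    rwa [zero_add] at h3
  have hFcont : ContinuousOn F s := (hF.convexOn fun r => by positivity).continuousOn hopen
  obtain ⟨R, hR⟩ := hF.exists_norm_sub_le hm hopen hw₀
  have hGcont : Continuous G := by
    rw [← continuousOn_univ]
    exact (hG.convexOn fun r => by positivity).continuousOn isOpen_univ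
  have hlow : ∀ h : E → ℝ, Continuous h → ∃ b, ∀ w ∈ Metric.closedBall w₀ R, b ≤ h w := by
    intro h hh
    obtain ⟨b, hb⟩ := ((isCompact_closedBall w₀ R).image hh).bddBelow
    exact ⟨b, fun w hw => hb ⟨w, hw, rfl⟩⟩
  obtain ⟨bG, hbG⟩ := hlow G hGcont
  choose b hb using fun i => hlow (fun w => f i 1 + f' i 1 * (⟪w, x i⟫ - 1)) (by fun_prop)
  have hfb : ∀ i, ∀ w ∈ s, w ∈ Metric.closedBall w₀ R → b i ≤ f i ⟪w, x i⟫ := fun i w hw hwR =>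
    (hb i w hwR).trans ((hf i).add_deriv_mul_sub_le one_pos (hw i) (hd i 1 one_pos))
  classical
  have hε : ∀ i, ∃ ε, 0 < ε ∧ ∀ w ∈ s, F w ≤ F w₀ → ε ≤ ⟪w, x i⟫ := by
    intro i
    have hev := (hlim i).eventually_gt_atTop ((F w₀ - bG) / c - ∑ j ∈ univ.erase i, b j)
    obtain ⟨ε, hε, hsub⟩ := mem_nhdsGT_iff_exists_Ioo_subset.1 hev
    refine ⟨ε, hε, fun w hw hle => ?_⟩
    by_contra! hlt
    have hwR : w ∈ Metric.closedBall w₀ R := mem_closedBall_iff_norm.2 (hR w hw hle)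
    have h1 : (F w₀ - bG) / c - ∑ j ∈ univ.erase i, b j < f i ⟪w, x i⟫ := hsub ⟨hw i, hlt⟩
    have h2 : ∑ j ∈ univ.erase i, b j ≤ ∑ j ∈ univ.erase i, f j ⟪w, x j⟫ :=
      sum_le_sum fun j _ => hfb j w hw hwR
    have h3 := add_sum_erase univ (fun j => f j ⟪w, x j⟫) (mem_univ i)
    have h4 := hbG w hwR
    have h5 : (F w₀ - bG) / c < ∑ j, f j ⟪w, x j⟫ := by rw [← h3]; linarith
    rw [div_lt_iff₀ hc] at h5
    simp only [hFdef] at hle h5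
    linarith
  choose ε hεpos hε using hε
  have hKcompact : IsCompact (Metric.closedBall w₀ R ∩ {w | ∀ i, ε i ≤ ⟪w, x i⟫}) := by
    refine (isCompact_closedBall w₀ R).inter_right ?_
    simp only [ofPred_forall]
    exact isClosed_iInter fun i => isClosed_le continuous_const (by fun_prop)
  have hsublevel : ∀ w ∈ s, F w ≤ F w₀ →
      w ∈ Metric.closedBall w₀ R ∩ {w | ∀ i, ε i ≤ ⟪w, x i⟫} := fun w hw hle =>
    ⟨mem_closedBall_iff_norm.2 (hR w hw hle), fun i => hε i w hw hle⟩
  have hKs : Metric.closedBall w₀ R ∩ {w | ∀ i, ε i ≤ ⟪w, x i⟫} ⊆ s := fun w hw i =>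
    (hεpos i).trans_le (hw.2 i)
  obtain ⟨w, hwK, hmin⟩ := hKcompact.exists_isMinOn ⟨w₀, hsublevel w₀ hw₀ le_rfl⟩
    (hFcont.mono hKs)
  refine ⟨w, hKs hwK, fun u hu => ?_⟩
  rcases le_total (F u) (F w₀) with h | h
  · exact hmin (hsublevel u hu h)
  · exact (hmin (hsublevel w₀ hw₀ le_rfl)).trans h

/-- The gradient of `w ↦ c * ∑ i, f i ⟪w, x i⟫`. -/
lemma hasGradientAt_sum_comp_inner [CompleteSpace E] {a : ι → ℝ} {w : E} (c : ℝ)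
    (hd : ∀ i, HasDerivAt (f i) (a i) ⟪w, x i⟫) :
    HasGradientAt (fun w => c * ∑ i, f i ⟪w, x i⟫) (c • ∑ i, a i • x i) w := by
  rw [hasGradientAt_iff_hasFDerivAt]
  have hi : ∀ i, HasFDerivAt (fun w => f i ⟪w, x i⟫) (a i • innerSL ℝ (x i)) w := by
    intro i
    have hinner : HasFDerivAt (fun w => ⟪w, x i⟫) (innerSL ℝ (x i)) w := by
      simpa [real_inner_comm] using (innerSL ℝ (x i)).hasFDerivAt (x := w)
    exact (hd i).comp_hasFDerivAt w hinner
  refine ((HasFDerivAt.fun_sum fun i _ => hi i).const_mul c).congr_fderiv ?_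
  ext v
  simp

end Minimization

/-- strong duality, Proposition 1: under the stated assumptions, the primal
minimum over the open polytope `Π(X)` and the dual maximum are attained, are equal, and
the KKT conditions `α_i* = −f_i'(w*ᵀx_i)` and `w* = ∇g*((1/(λn))·∑ α_i* x_i − ψ/λ)` hold. -/
theorem strong_duality
    (d n : ℕ) (hn : 0 < n)
    (ψ : EuclideanSpace ℝ (Fin d)) (x : Fin n → EuclideanSpace ℝ (Fin d))
    (lam : ℝ) (hlam : 0 < lam)
    (f f' : Fin n → ℝ → ℝ)
    (hconv : ∀ i, ConvexOn ℝ (Ioi 0) (f i))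
    (hdiff : ∀ i, ∀ t ∈ Ioi (0:ℝ), HasDerivWithinAt (f i) (f' i t) (Ioi 0) t)
    (hlim : ∀ i, Filter.Tendsto (f i) (nhdsWithin 0 (Ioi 0)) Filter.atTop)
    (g : EuclideanSpace ℝ (Fin d) → ℝ) (hg : StrongConvexOn univ 1 g)
    (P : EuclideanSpace ℝ (Fin d) → ℝ)
    (hP : P = fun w => ⟪ψ, w⟫ + (1 / (n : ℝ)) * ∑ i, f i ⟪w, x i⟫ + lam * g w)
    (Pol : Set (EuclideanSpace ℝ (Fin d)))
    (hPol : Pol = {w | ∀ i, 0 < ⟪w, x i⟫}) (hne : Pol.Nonempty)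
    (Ddual : (Fin n → ℝ) → ℝ)
    (hD : Ddual = fun α => (1 / (n : ℝ)) * ∑ i, -(fenchel (Ioi 0) (f i) (-(α i)))
        - lam * fenchelE g ((1 / (lam * n)) • ∑ i, α i • x i - (1 / lam) • ψ)) :
    ∃ wstar ∈ Pol, ∃ αstar : Fin n → ℝ,
      (∀ i, -(αstar i) ∈ fenchelDom (Ioi 0) (f i)) ∧
      (∀ w ∈ Pol, P wstar ≤ P w) ∧
      (∀ α : Fin n → ℝ, (∀ i, -(α i) ∈ fenchelDom (Ioi 0) (f i)) → Ddual α ≤ Ddual αstar) ∧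
      P wstar = Ddual αstar ∧
      (∀ i, αstar i = -(f' i ⟪wstar, x i⟫)) ∧
      wstar = gradient (fenchelE g) ((1 / (lam * n)) • ∑ i, αstar i • x i - (1 / lam) • ψ) := by
  subst hP hPol hD
  have hn' : (0 : ℝ) < n := Nat.cast_pos.2 hn
  have hd : ∀ i, ∀ t, 0 < t → HasDerivAt (f i) (f' i t) t := fun i t ht =>
    (hdiff i t ht).hasDerivAt (Ioi_mem_nhds ht)
  have hG : StrongConvexOn univ lam fun w => ⟪ψ, w⟫ + lam * g w := by
    refine ⟨convex_univ, fun u _ v _ a b ha hb hab => ?_⟩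
    have h := mul_le_mul_of_nonneg_left (hg.2 (mem_univ u) (mem_univ v) ha hb hab) hlam.le
    simp only [inner_add_right, real_inner_smul_right, smul_eq_mul] at h ⊢
    linarith
  obtain ⟨w, hw, hmin⟩ := exists_isMinOn_polytope (c := 1 / (n : ℝ)) (by positivity) hlam hconv hd
    hlim hG hne
  set θ := (1 / (lam * n)) • ∑ i, -(f' i ⟪w, x i⟫) • x i - (1 / lam) • ψ with hθ
  have hquad : ∀ u, ⟪θ, u - w⟫ + 1 / 2 * ‖u - w‖ ^ 2 ≤ g u - g w := by
    intro u
    have hgrad := hasGradientAt_sum_comp_inner (x := x) (1 / (n : ℝ)) fun i => hd i _ (hw i)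
    rw [← neg_neg ((1 / (n : ℝ)) • _)] at hgrad
    have h := (hmin.isLocalMin ((isOpen_setOf_forall_inner_pos x).mem_nhds hw)).inner_add_le_sub
      hgrad hG u
    have hθψ : -((1 / (n : ℝ)) • ∑ i, f' i ⟪w, x i⟫ • x i) = lam • θ + ψ := by
      rw [hθ]
      simp only [neg_smul, sum_neg_distrib, smul_sub, smul_smul, smul_neg]
      rw [mul_one_div_cancel hlam.ne', one_smul, sub_add_cancel]
      congr 2
      field_simp
    rw [hθψ, inner_add_left, real_inner_smul_left, inner_sub_right ψ] at h
    nlinarith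
  have hpair : ∀ α : Fin n → ℝ,
      lam * ⟪w, (1 / (lam * n)) • ∑ i, α i • x i - (1 / lam) • ψ⟫
        = (1 / (n : ℝ)) * ∑ i, α i * ⟪w, x i⟫ - ⟪ψ, w⟫ := by
    intro α
    simp only [inner_sub_right, real_inner_smul_right, inner_sum, real_inner_comm w ψ]
    field_simp
  have hweak : ∀ α : Fin n → ℝ, (∀ i, -(α i) ∈ fenchelDom (Ioi 0) (f i)) →
      (1 / (n : ℝ)) * ∑ i, -(fenchel (Ioi 0) (f i) (-(α i)))
        - lam * fenchelE g ((1 / (lam * n)) • ∑ i, α i • x i - (1 / lam) • ψ)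
      ≤ ⟪ψ, w⟫ + (1 / (n : ℝ)) * ∑ i, f i ⟪w, x i⟫ + lam * g w := by
    intro α hα
    have h1 : (1 / (n : ℝ)) * ∑ i, -(fenchel (Ioi 0) (f i) (-(α i)))
        ≤ (1 / (n : ℝ)) * ∑ i, (α i * ⟪w, x i⟫ + f i ⟪w, x i⟫) := by
      gcongr with i
      have := mul_sub_le_fenchel (hα i) (hw i)
      linarith
    have h2 := mul_le_mul_of_nonneg_left (inner_sub_le_fenchelE hquad
      ((1 / (lam * n)) • ∑ i, α i • x i - (1 / lam) • ψ) w) hlam.le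
    rw [mul_sub, hpair] at h2
    rw [sum_add_distrib, mul_add] at h1
    linarith
  have hstrong : ⟪ψ, w⟫ + (1 / (n : ℝ)) * ∑ i, f i ⟪w, x i⟫ + lam * g w
      = (1 / (n : ℝ)) * ∑ i, -(fenchel (Ioi 0) (f i) (- -(f' i ⟪w, x i⟫)))
        - lam * fenchelE g θ := by
    have h1 : ∀ i, -(fenchel (Ioi 0) (f i) (- -(f' i ⟪w, x i⟫)))
        = -(f' i ⟪w, x i⟫) * ⟪w, x i⟫ + f i ⟪w, x i⟫ := by
      intro i
      rw [neg_neg, fenchel,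
        (isGreatest_fenchel_of_hasDerivAt (hconv i) (hw i) (hd i _ (hw i))).csSup_eq]
      ring
    have h2 := hpair fun i => -(f' i ⟪w, x i⟫)
    rw [fenchelE_eq_of_quadratic_minorant hquad, mul_sub, hθ, h2, sum_congr rfl fun i _ => h1 i,
      sum_add_distrib]
    ring
  refine ⟨w, hw, fun i => -(f' i ⟪w, x i⟫), fun i => ?_, fun u hu => ?_, fun α hα => ?_, hstrong,
    fun i => rfl, (hasGradientAt_fenchelE_of_quadratic_minorant hquad).gradient.symm⟩
  · have h := isGreatest_fenchel_of_hasDerivAt (hconv i) (hw i) (hd i _ (hw i))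
    rw [neg_neg]
    exact ⟨h.nonempty, h.bddAbove⟩
  · have h : (1 / (n : ℝ)) * ∑ i, f i ⟪w, x i⟫ + (⟪ψ, w⟫ + lam * g w)
        ≤ (1 / (n : ℝ)) * ∑ i, f i ⟪u, x i⟫ + (⟪ψ, u⟫ + lam * g u) := hmin hu
    simp only
    linarith
  · exact (hweak α hα).trans hstrong.le
end

section
/- There exists ε > 0 such that the constrained problem min_{w ∈ Π_{|ε}(X)} P(w), where Π_{|ε}(X) = {w ∈ ℝ^d : wᵀx_i ≥ ε for all i = 1, …, n}, has a (unique) solution w* that is also a minimizer of P over the open polytope Π(X): P(w*) ≤ P(w) for all w ∈ Π(X). -/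
open Real Set Finset
open scoped RealInnerProductSpace

/-- A sublevel set of a strongly convex function is bounded. -/
theorem StrongConvexOn.exists_forall_norm_sub_le {E : Type*} [NormedAddCommGroup E]
    [NormedSpace ℝ E] {s : Set E} {m r B : ℝ} {φ : E → ℝ} {x₀ : E}
    (hφ : StrongConvexOn s m φ) (hm : 0 < m) (hr : 0 < r)
    (hball : ∀ u, ‖u - x₀‖ ≤ r → u ∈ s ∧ φ x₀ - B ≤ φ u) :
    ∃ R, ∀ w ∈ s, φ w ≤ φ x₀ → ‖w - x₀‖ ≤ R := by
  refine ⟨r + 2 * B / (m * r), fun w hw hle => ?_⟩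
  have hB : 0 ≤ B := by
    have := (hball x₀ (by simpa using hr.le)).2
    linarith
  have hx₀ : x₀ ∈ s := (hball x₀ (by simpa using hr.le)).1
  rcases le_or_gt ‖w - x₀‖ r with h | h
  · have : 0 ≤ 2 * B / (m * r) := by positivity
    linarith
  set D := ‖w - x₀‖ with hD
  have hDpos : 0 < D := hr.trans h
  have ht : 0 < r / D := by positivity
  have ht1 : r / D ≤ 1 := (div_le_one hDpos).2 h.le
  have key := hφ.2 hw hx₀ ht.le (sub_nonneg.2 ht1) (by ring)
  have hu : ‖((r / D) • w + (1 - r / D) • x₀) - x₀‖ ≤ r := by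
    have : ((r / D) • w + (1 - r / D) • x₀) - x₀ = (r / D) • (w - x₀) := by module
    rw [this, norm_smul, Real.norm_of_nonneg ht.le, ← hD, div_mul_cancel₀ _ hDpos.ne']
  have hlow := (hball _ hu).2
  simp only [smul_eq_mul, ← hD] at key
  have hmul : r / D * φ w ≤ r / D * φ x₀ := mul_le_mul_of_nonneg_left hle ht.le
  have hquad : r / D * (1 - r / D) * (m / 2 * D ^ 2) = m * r / 2 * (D - r) := by
    field_simp
  have hmr : 0 < m * r := mul_pos hm hr
  have : D - r ≤ 2 * B / (m * r) := by
    rw [le_div_iff₀ hmr]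
    linarith
  linarith

/-- A continuous function on `(0, ∞)` that blows up at `0` is bounded below on `(0, M]`. -/
theorem ContinuousOn.exists_forall_le_of_tendsto_atTop {f : ℝ → ℝ}
    (hf : ContinuousOn f (Ioi 0)) (hlim : Filter.Tendsto f (nhdsWithin 0 (Ioi 0)) Filter.atTop)
    (M : ℝ) : ∃ c, ∀ t, 0 < t → t ≤ M → c ≤ f t := by
  obtain ⟨δ, hδ, hδf⟩ := mem_nhdsGT_iff_exists_Ioo_subset.1
    (hlim.eventually (Filter.eventually_ge_atTop 0))
  obtain ⟨c, hc⟩ := (isCompact_Icc (a := δ) (b := M)).bddBelow_image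
    (hf.mono fun t ht => lt_of_lt_of_le hδ ht.1)
  refine ⟨min 0 c, fun t ht htM => ?_⟩
  rcases lt_or_ge t δ with h | h
  · exact (min_le_left _ _).trans (hδf ⟨ht, h⟩)
  · exact (min_le_right _ _).trans (hc ⟨t, ⟨h, htM⟩, rfl⟩)

/-- If a finite sum of functions bounded below on `(0, M]` and blowing up at `0` is bounded above,
then the arguments are uniformly bounded away from `0`. -/
theorem exists_pos_forall_le_of_sum_le {ι : Type*} [Fintype ι] {f : ι → ℝ → ℝ}
    (hf : ∀ i, ContinuousOn (f i) (Ioi 0))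
    (hlim : ∀ i, Filter.Tendsto (f i) (nhdsWithin 0 (Ioi 0)) Filter.atTop) (M C : ℝ) :
    ∃ ε > (0 : ℝ), ∀ t : ι → ℝ, (∀ i, 0 < t i) → (∀ i, t i ≤ M) → ∑ i, f i (t i) ≤ C →
      ∀ i, ε ≤ t i := by
  choose c hc using fun i => (hf i).exists_forall_le_of_tendsto_atTop (hlim i) M
  have hδ : ∀ i, ∃ δ > (0 : ℝ), Set.Ioo 0 δ ⊆ {t : ℝ | C - ∑ j, c j + c i < f i t} := fun i =>
    mem_nhdsGT_iff_exists_Ioo_subset.1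
      ((hlim i).eventually (Filter.eventually_gt_atTop (C - ∑ j, c j + c i)))
  choose δ hδ hδf using hδ
  obtain ⟨ε, hε, hεδ⟩ : ∃ ε > (0 : ℝ), ∀ i, ε ≤ δ i := by
    rcases isEmpty_or_nonempty ι with _ | _
    · exact ⟨1, one_pos, isEmptyElim⟩
    · obtain ⟨i₀, hi₀⟩ := Finite.exists_min δ
      exact ⟨δ i₀, hδ i₀, hi₀⟩
  refine ⟨ε, hε, fun t ht htM hsum i => (hεδ i).trans ?_⟩
  by_contra! hlt
  have h1 : C - ∑ j, c j + c i < f i (t i) := hδf i ⟨ht i, hlt⟩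
  have h2 : f i (t i) - c i ≤ ∑ j, (f j (t j) - c j) :=
    Finset.single_le_sum (f := fun j => f j (t j) - c j)
      (fun j _ => sub_nonneg.2 (hc j _ (ht j) (htM j))) (Finset.mem_univ i)
  rw [Finset.sum_sub_distrib] at h2
  linarith

/-- Lemma 1: there exists `ε > 0` such that the problem of minimizing `P`
over the closed polytope `Π_{|ε}(X) = {w : wᵀx_i ≥ ε ∀i}` has a unique solution `w*`,
which also minimizes `P` over the open polytope `Π(X)`. -/
theorem constrained_problem_equivalence
    (d n : ℕ) (hn : 0 < n)
    (ψ : EuclideanSpace ℝ (Fin d)) (x : Fin n → EuclideanSpace ℝ (Fin d))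
    (lam : ℝ) (hlam : 0 < lam)
    (f f' : Fin n → ℝ → ℝ)
    (hconv : ∀ i, ConvexOn ℝ (Ioi 0) (f i))
    (hdiff : ∀ i, ∀ t ∈ Ioi (0:ℝ), HasDerivWithinAt (f i) (f' i t) (Ioi 0) t)
    (hlim : ∀ i, Filter.Tendsto (f i) (nhdsWithin 0 (Ioi 0)) Filter.atTop)
    (g : EuclideanSpace ℝ (Fin d) → ℝ) (hg : StrongConvexOn univ 1 g)
    (P : EuclideanSpace ℝ (Fin d) → ℝ)
    (hP : P = fun w => ⟪ψ, w⟫ + (1 / (n : ℝ)) * ∑ i, f i ⟪w, x i⟫ + lam * g w)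
    (Pol : Set (EuclideanSpace ℝ (Fin d)))
    (hPol : Pol = {w | ∀ i, 0 < ⟪w, x i⟫}) (hne : Pol.Nonempty) :
    ∃ ε > (0:ℝ), ∃ wstar ∈ {w : EuclideanSpace ℝ (Fin d) | ∀ i, ε ≤ ⟪w, x i⟫},
      (∀ w ∈ {w : EuclideanSpace ℝ (Fin d) | ∀ i, ε ≤ ⟪w, x i⟫}, P wstar ≤ P w) ∧
      (∀ w' ∈ {w : EuclideanSpace ℝ (Fin d) | ∀ i, ε ≤ ⟪w, x i⟫},
        (∀ w ∈ {w : EuclideanSpace ℝ (Fin d) | ∀ i, ε ≤ ⟪w, x i⟫}, P w' ≤ P w) →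
          w' = wstar) ∧
      (∀ w ∈ Pol, P wstar ≤ P w) := by
  have hcont : ∀ i, ContinuousOn (f i) (Ioi 0) := fun i => (hconv i).continuousOn isOpen_Ioi
  have hgcont : Continuous g := by
    have : ConvexOn ℝ univ g := strongConvexOn_zero.1 (hg.mono zero_le_one)
    simpa [continuousOn_univ] using this.continuousOn isOpen_univ
  have hPolopen : IsOpen Pol := by
    rw [hPol, ofPred_forall]
    exact isOpen_iInter_of_finite fun i => isOpen_lt continuous_const (by fun_prop)
  have hPolconv : Convex ℝ Pol := by
    rw [hPol]
    intro u hu v hv a b ha hb hab i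
    simp only [inner_add_left, real_inner_smul_left]
    exact (convex_Ioi (0 : ℝ)) (hu i) (hv i) ha hb hab
  have hPstrong : StrongConvexOn Pol lam P := by
    refine ⟨hPolconv, fun u hu v hv a b ha hb hab => ?_⟩
    have hsum : ∑ i, f i ⟪a • u + b • v, x i⟫ ≤
        a * ∑ i, f i ⟪u, x i⟫ + b * ∑ i, f i ⟪v, x i⟫ := by
      rw [Finset.mul_sum, Finset.mul_sum, ← Finset.sum_add_distrib]
      refine Finset.sum_le_sum fun i _ => ?_
      rw [hPol] at hu hv
      simpa only [inner_add_left, real_inner_smul_left, smul_eq_mul] using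
        (hconv i).2 (hu i) (hv i) ha hb hab
    have hgi := mul_le_mul_of_nonneg_left
      (hg.2 (mem_univ u) (mem_univ v) ha hb hab) hlam.le
    have hsum' := mul_le_mul_of_nonneg_left hsum (by positivity : 0 ≤ 1 / (n : ℝ))
    simp only [hP, inner_add_right, real_inner_smul_right, smul_eq_mul] at hgi ⊢
    linear_combination hgi + hsum'
  have hPcont : ContinuousOn P Pol :=
    (hPstrong.strictConvexOn hlam).convexOn.continuousOn hPolopen
  obtain ⟨w₀, hw₀⟩ := hne
  obtain ⟨r, hr, hball⟩ : ∃ r > 0, ∀ u, ‖u - w₀‖ ≤ r → u ∈ Pol ∧ P w₀ - 1 ≤ P u := by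
    have hev : ∀ᶠ u in nhds w₀, u ∈ Pol ∧ P w₀ - 1 ≤ P u :=
      (hPolopen.eventually_mem hw₀).and
        ((hPcont.continuousAt (hPolopen.mem_nhds hw₀)).eventually_const_le (sub_one_lt _))
    obtain ⟨r, hr, h⟩ := Metric.nhds_basis_closedBall.eventually_iff.1 hev
    exact ⟨r, hr, fun u hu => h (by simpa [dist_eq_norm] using hu)⟩
  obtain ⟨R, hR⟩ := hPstrong.exists_forall_norm_sub_le hlam hr hball
  have hcompact : IsCompact (Metric.closedBall w₀ R) := isCompact_closedBall _ _
  obtain ⟨L, hL⟩ := hcompact.bddBelow_image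
    (f := fun w => ⟪ψ, w⟫ + lam * g w) (by fun_prop)
  have hM : ∃ M, ∀ i, ∀ w ∈ Metric.closedBall w₀ R, ⟪w, x i⟫ ≤ M := by
    have hbdd : ∀ i, ∃ M, ∀ w ∈ Metric.closedBall w₀ R, ⟪w, x i⟫ ≤ M := fun i => by
      obtain ⟨M, hM⟩ := hcompact.bddAbove_image (f := fun w => ⟪w, x i⟫) (by fun_prop)
      exact ⟨M, fun w hw => hM ⟨w, hw, rfl⟩⟩
    choose M hM using hbdd
    obtain ⟨M', hM'⟩ := (Set.finite_range M).bddAbove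
    exact ⟨M', fun i w hw => (hM i w hw).trans (hM' ⟨i, rfl⟩)⟩
  obtain ⟨M, hM⟩ := hM
  obtain ⟨ε, hε, hεt⟩ := exists_pos_forall_le_of_sum_le hcont hlim M (n * (P w₀ - L))
  have hn' : (0 : ℝ) < n := Nat.cast_pos.2 hn
  set S := {w : EuclideanSpace ℝ (Fin d) | ∀ i, ε ≤ ⟪w, x i⟫} with hS
  have hSclosed : IsClosed S := by
    rw [hS, ofPred_forall]
    exact isClosed_iInter fun i => isClosed_le continuous_const (by fun_prop)
  have hSPol : S ⊆ Pol := fun w hw => hPol ▸ fun i => hε.trans_le (hw i)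
  have hsub : ∀ w ∈ Pol, P w ≤ P w₀ → w ∈ S ∩ Metric.closedBall w₀ R := by
    intro w hw hle
    have hwR : w ∈ Metric.closedBall w₀ R := by simpa [dist_eq_norm] using hR w hw hle
    refine ⟨hεt (fun i => ⟪w, x i⟫) (by rw [hPol] at hw; exact hw) (fun i => hM i w hwR) ?_, hwR⟩
    have hLw : L ≤ ⟪ψ, w⟫ + lam * g w := hL ⟨w, hwR, rfl⟩
    have hPw : P w = ⟪ψ, w⟫ + (1 / (n : ℝ)) * ∑ i, f i ⟪w, x i⟫ + lam * g w := by rw [hP]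
    rw [← div_le_iff₀' hn', div_eq_inv_mul, ← one_div]
    linarith
  have hw₀S := hsub w₀ hw₀ le_rfl
  obtain ⟨wstar, hwstar, hmin⟩ := (hcompact.inter_left hSclosed).exists_isMinOn ⟨w₀, hw₀S⟩
    (hPcont.mono (inter_subset_left.trans hSPol))
  have hglobal : ∀ w ∈ Pol, P wstar ≤ P w := fun w hw =>
    (le_total (P w) (P w₀)).elim (fun h => hmin (hsub w hw h)) (fun h => (hmin hw₀S).trans h)
  refine ⟨ε, hε, wstar, hwstar.1, fun w hw => hglobal w (hSPol hw), fun w' hw' hmin' => ?_,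
    hglobal⟩
  exact (hPstrong.strictConvexOn hlam).eq_of_isMinOn
    (fun w hw => (hmin' wstar hwstar.1).trans (hglobal w hw)) hglobal (hSPol hw') (hSPol hwstar.1)
end

section
/- (Key lemma for shifted SDCA.) Assume each f_i is L_i-log smooth with differentiable Fenchel conjugate, g is 1-strongly convex, and bounds β_i ∈ −D_{f*} satisfy β_i/α_i* ≥ 1 for all i, where α* is the dual maximizer. Let α^{(t−1)} ∈ (−D_{f*})^n satisfy β_i/α_i^{(t−1)} ≥ 1 for all i, and for each i let α^{(t,i)} be the result of the Shifted SDCA update for coordinate i applied to α^{(t−1)}. Then for any s_1, …, s_n ∈ (0, 1], ∑_{i=1}^n s_i^{−1}·( D(α^{(t,i)}) − D(α^{(t−1)}) ) ≥ D(α*) − D(α^{(t−1)}) + (1/n)·∑_{i=1}^n ( L_i·γ(s_i, α_i^{(t−1)}, α_i*) − (s_i/(2λn))·‖x_i‖²·(α_i* − α_i^{(t−1)})² ), where γ(s, a, b) = (1/s)·log(1 − s + s·b/a) − log(b/a). -/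
open Real Set Finset
open scoped RealInnerProductSpace

/-- `f` (with derivative `f'` on its domain `D`) is `L`-log smooth. -/
def LogSmooth (L : ℝ) (D : Set ℝ) (f' : ℝ → ℝ) : Prop :=
  ∀ x ∈ D, ∀ y ∈ D, |f' x - f' y| ≤ (1 / L) * (f' x * f' y * |x - y|)

/-- `γ(s, a, b) = (1/s)·log(1 − s + s·b/a) − log(b/a)`. -/
noncomputable def gam (s a b : ℝ) : ℝ :=
  s⁻¹ * Real.log (1 - s + s * (b / a)) - Real.log (b / a)

lemma Finset.sum_apply_update {ι M : Type*} [Fintype ι] [DecidableEq ι] [AddCommGroup M]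
    {α : Type*} (F : ι → α → M) (a : ι → α) (i : ι) (t : α) :
    ∑ j, F j (Function.update a i t j) = ∑ j, F j (a j) + (F i t - F i (a i)) := by
  rw [← sub_eq_iff_eq_add', ← sum_sub_distrib,
    sum_eq_single_of_mem i (mem_univ i) fun j _ hj => by simp [hj]]
  simp

namespace LogSmooth

variable {f f' : ℝ → ℝ} {L : ℝ}

/-- Tangent line inequality for a differentiable convex function on `(0, ∞)`. -/
lemma tangent_le (hconv : ConvexOn ℝ (Ioi 0) f)
    (hdiff : ∀ t ∈ Ioi (0 : ℝ), HasDerivWithinAt f (f' t) (Ioi 0) t)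
    {x y : ℝ} (hx : 0 < x) (hy : 0 < y) : f x + f' x * (y - x) ≤ f y := by
  have hd : HasDerivAt f (f' x) x := (hdiff x hx).hasDerivAt (Ioi_mem_nhds hx)
  rcases lt_trichotomy x y with h | rfl | h
  · have := hconv.le_slope_of_hasDerivAt hx hy h hd
    rw [slope_def_field, le_div_iff₀ (by linarith)] at this
    linarith
  · simp
  · have := hconv.slope_le_of_hasDerivAt hy hx h hd
    rw [slope_def_field, div_le_iff₀ (by linarith)] at this
    linarith

lemma exists_deriv_lt (hconv : ConvexOn ℝ (Ioi 0) f)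
    (hdiff : ∀ t ∈ Ioi (0 : ℝ), HasDerivWithinAt f (f' t) (Ioi 0) t)
    (hlim : Filter.Tendsto f (nhdsWithin 0 (Ioi 0)) Filter.atTop)
    {δ : ℝ} (hδ : 0 < δ) (M : ℝ) : ∃ x, 0 < x ∧ x < δ ∧ f' x < M := by
  have hδ' : 0 < min δ 1 := lt_min hδ one_pos
  obtain ⟨x, hfx, hx0, hx1⟩ :=
    ((hlim.eventually_gt_atTop (f 1 + |M|)).and (Ioo_mem_nhdsGT hδ')).exists
  rw [lt_min_iff] at hx1
  refine ⟨x, hx0, hx1.1, ?_⟩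
  have h := tangent_le hconv hdiff hx0 one_pos
  by_contra! hM
  nlinarith [neg_abs_le M, abs_nonneg M]

lemma deriv_neg (hconv : ConvexOn ℝ (Ioi 0) f)
    (hdiff : ∀ t ∈ Ioi (0 : ℝ), HasDerivWithinAt f (f' t) (Ioi 0) t)
    (hlim : Filter.Tendsto f (nhdsWithin 0 (Ioi 0)) Filter.atTop)
    (hL : 0 < L) (hls : LogSmooth L (Ioi 0) f') {y : ℝ} (hy : 0 < y) : f' y < 0 := by
  obtain ⟨x, hx0, hxy, hx⟩ := exists_deriv_lt hconv hdiff hlim hy 0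
  by_contra! h
  have h1 := hls x hx0 y hy
  have h2 : (1 / L) * (f' x * f' y * |x - y|) ≤ 0 :=
    mul_nonpos_of_nonneg_of_nonpos (by positivity)
      (mul_nonpos_of_nonpos_of_nonneg (mul_nonpos_of_nonpos_of_nonneg hx.le h) (abs_nonneg _))
  linarith [neg_abs_le (f' x - f' y)]

lemma mul_abs_le (hL : 0 < L) (hls : LogSmooth L (Ioi 0) f') {x y : ℝ} (hx : 0 < x) (hy : 0 < y) :
    L * |f' x - f' y| ≤ f' x * f' y * |x - y| := by
  have h := mul_le_mul_of_nonneg_left (hls x hx y hy) hL.le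
  rwa [← mul_assoc, mul_one_div_cancel hL.ne', one_mul] at h

lemma le_neg_deriv_mul (hconv : ConvexOn ℝ (Ioi 0) f)
    (hdiff : ∀ t ∈ Ioi (0 : ℝ), HasDerivWithinAt f (f' t) (Ioi 0) t)
    (hlim : Filter.Tendsto f (nhdsWithin 0 (Ioi 0)) Filter.atTop)
    (hL : 0 < L) (hls : LogSmooth L (Ioi 0) f') {x : ℝ} (hx : 0 < x) : L ≤ -f' x * x := by
  by_contra! hlt
  have hneg := deriv_neg hconv hdiff hlim hL hls hx
  obtain ⟨z, hz0, hzx, hz⟩ :=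
    exists_deriv_lt hconv hdiff hlim hx (L * f' x / (L + f' x * x))
  have hpos : 0 < L + f' x * x := by linarith
  rw [lt_div_iff₀ hpos] at hz
  have hzneg := deriv_neg hconv hdiff hlim hL hls hz0
  have h := mul_abs_le hL hls hx hz0
  rw [abs_of_pos (sub_pos.2 hzx)] at h
  nlinarith [le_abs_self (f' x - f' z), mul_pos (mul_pos_of_neg_of_neg hneg hzneg) hz0]

/-- A log smooth function lies below its logarithmic osculant at every point. -/
lemma le_sub_log (hconv : ConvexOn ℝ (Ioi 0) f)
    (hdiff : ∀ t ∈ Ioi (0 : ℝ), HasDerivWithinAt f (f' t) (Ioi 0) t)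
    (hlim : Filter.Tendsto f (nhdsWithin 0 (Ioi 0)) Filter.atTop)
    (hL : 0 < L) (hls : LogSmooth L (Ioi 0) f') {x y : ℝ} (hx : 0 < x) (hy : 0 < y)
    (hxy : 0 < 1 + -f' x * (y - x) / L) :
    f y ≤ f x - L * log (1 + -f' x * (y - x) / L) := by
  set F : ℝ → ℝ := fun y => f y + L * log (1 + -f' x * (y - x) / L) with hF
  have hneg : ∀ {z}, 0 < z → f' z < 0 := fun hz => deriv_neg hconv hdiff hlim hL hls hz
  have hargeq : ∀ z, 1 + -f' x * (z - x) / L = (L + -f' x * (z - x)) / L := fun z => by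
    field_simp
  have hargy : 0 < L + -f' x * (y - x) := by
    rw [hargeq] at hxy
    exact (div_pos_iff_of_pos_right hL).1 hxy
  have harg : ∀ z, min x y ≤ z → 0 < L + -f' x * (z - x) := fun z hz => by
    rcases min_le_iff.1 hz with h | h <;> nlinarith [hneg hx]
  have hpos : ∀ {z}, min x y ≤ z → 0 < z := fun hz => (lt_min hx hy).trans_le hz
  have hder : ∀ z, min x y ≤ z →
      HasDerivAt F (f' z + L * -f' x / (L + -f' x * (z - x))) z := fun z hz => by
    have h1 : HasDerivAt f (f' z) z := (hdiff z (hpos hz)).hasDerivAt (Ioi_mem_nhds (hpos hz))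
    have h2 : HasDerivAt (fun y => 1 + -f' x * (y - x) / L) (-f' x / L) z := by
      simpa using ((((hasDerivAt_id z).sub_const x).const_mul (-f' x)).div_const L).const_add 1
    have h3 := h2.log (by rw [hargeq]; exact (div_pos (harg z hz) hL).ne')
    refine (h1.add (h3.const_mul L)).congr_deriv ?_
    rw [hargeq]
    have := (harg z hz).ne'
    field_simp
  have hcont : ∀ {a b : ℝ}, min x y ≤ a → ContinuousOn F (Icc a b) := fun ha z hz =>
    (hder z (ha.trans hz.1)).continuousAt.continuousWithinAt
  have hFx : F x = f x := by simp [hF]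
  suffices F y ≤ F x by rw [hFx] at this; simp only [hF] at this; linarith
  rcases le_total x y with hxy | hxy
  · refine antitoneOn_of_hasDerivWithinAt_nonpos (convex_Icc x y) (hcont (min_le_left x y))
      (fun z hz => (hder z ?_).hasDerivWithinAt) (fun z hz => ?_)
      (left_mem_Icc.2 hxy) (right_mem_Icc.2 hxy) hxy
    all_goals rw [interior_Icc] at hz; have hz0 : min x y ≤ z := (min_le_left x y).trans hz.1.le
    · exact hz0
    · have h := mul_abs_le hL hls (hpos hz0) hx
      rw [abs_of_pos (sub_pos.2 hz.1)] at h
      rw [← le_neg_iff_add_nonpos_left, div_le_iff₀ (harg z hz0)]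
      nlinarith [le_abs_self (f' z - f' x)]
  · refine monotoneOn_of_hasDerivWithinAt_nonneg (convex_Icc y x) (hcont (min_le_right x y))
      (fun z hz => (hder z ?_).hasDerivWithinAt) (fun z hz => ?_)
      (left_mem_Icc.2 hxy) (right_mem_Icc.2 hxy) hxy
    all_goals rw [interior_Icc] at hz; have hz0 : min x y ≤ z := (min_le_right x y).trans hz.1.le
    · exact hz0
    · have h := mul_abs_le hL hls hx (hpos hz0)
      rw [abs_of_pos (sub_pos.2 hz.2)] at h
      rw [← neg_le_iff_add_nonneg', le_div_iff₀ (harg z hz0)]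
      nlinarith [le_abs_self (f' x - f' z)]

lemma pos_of_neg_mem_fenchelDom (hconv : ConvexOn ℝ (Ioi 0) f)
    (hdiff : ∀ t ∈ Ioi (0 : ℝ), HasDerivWithinAt f (f' t) (Ioi 0) t)
    (hlim : Filter.Tendsto f (nhdsWithin 0 (Ioi 0)) Filter.atTop)
    (hL : 0 < L) (hls : LogSmooth L (Ioi 0) f') {a : ℝ} (ha : -a ∈ fenchelDom (Ioi 0) f) :
    0 < a := by
  by_contra! ha0
  obtain ⟨B, hB⟩ := ha.2
  have hneg : 0 < -f' 1 := neg_pos.2 (deriv_neg hconv hdiff hlim hL hls one_pos)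
  set t := exp ((|f 1 + B| + 1) / L)
  have ht : 1 < t := one_lt_exp_iff.2 (by positivity)
  have hy' : 0 < (t - 1) * L / -f' 1 := div_pos (mul_pos (by linarith) hL) hneg
  set y := 1 + (t - 1) * L / -f' 1 with hy_def
  have hy : 0 < y := by linarith
  have h2 : 1 + -f' 1 * (y - 1) / L = t := by
    rw [hy_def, add_sub_cancel_left, mul_div_cancel₀ _ hneg.ne', mul_div_cancel_right₀ _ hL.ne']
    ring
  have h1 := le_sub_log hconv hdiff hlim hL hls one_pos hy (by rw [h2]; positivity)
  rw [h2, log_exp, mul_div_cancel₀ _ hL.ne'] at h1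
  have h3 := hB ⟨y, hy, rfl⟩
  simp only at h3
  nlinarith [le_abs_self (f 1 + B), mul_nonneg hy.le (neg_nonneg.2 ha0)]

lemma fenchel_le_of_deriv_eq (hconv : ConvexOn ℝ (Ioi 0) f)
    (hdiff : ∀ t ∈ Ioi (0 : ℝ), HasDerivWithinAt f (f' t) (Ioi 0) t)
    {x : ℝ} (hx : 0 < x) :
    f' x ∈ fenchelDom (Ioi 0) f ∧ fenchel (Ioi 0) f (f' x) ≤ x * f' x - f x := by
  have hbd : ∀ w ∈ (fun u => u * f' x - f u) '' Ioi 0, w ≤ x * f' x - f x := by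
    rintro _ ⟨u, hu, rfl⟩
    have := tangent_le hconv hdiff hx hu
    simp only
    linarith
  exact ⟨⟨⟨_, x, hx, rfl⟩, ⟨_, hbd⟩⟩, csSup_le ⟨_, x, hx, rfl⟩ hbd⟩

lemma exists_deriv_eq_neg (hconv : ConvexOn ℝ (Ioi 0) f)
    (hdiff : ∀ t ∈ Ioi (0 : ℝ), HasDerivWithinAt f (f' t) (Ioi 0) t)
    (hlim : Filter.Tendsto f (nhdsWithin 0 (Ioi 0)) Filter.atTop)
    {a p : ℝ} (ha : -a ∈ fenchelDom (Ioi 0) f) (hap : a < p) : ∃ x, 0 < x ∧ f' x = -p := by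
  obtain ⟨x₀, hx₀, -, hlt⟩ := exists_deriv_lt hconv hdiff hlim one_pos (-p)
  obtain ⟨x₁, hx₁, hgt⟩ : ∃ x, 0 < x ∧ -p ≤ f' x := by
    by_contra! hall
    obtain ⟨B, hB⟩ := ha.2
    set u := 1 + (|f 1 + B + a| + 1) / (p - a)
    have hpa : 0 < p - a := sub_pos.2 hap
    have hu1 : 0 < u - 1 := by simp only [u]; rw [add_sub_cancel_left]; positivity
    have hu : 0 < u := by linarith
    have h1 := tangent_le hconv hdiff hu one_pos
    have h2 := hB ⟨u, hu, rfl⟩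
    have h3 : (u - 1) * (p - a) = |f 1 + B + a| + 1 := by
      simp only [u]; field_simp; ring
    simp only at h2
    nlinarith [hall u hu, le_abs_self (f 1 + B + a)]
  obtain ⟨x, hx, hfx⟩ := (ordConnected_Ioi.image_hasDerivWithinAt hdiff).out
    (mem_image_of_mem f' hx₀) (mem_image_of_mem f' hx₁) ⟨hlt.le, hgt⟩
  exact ⟨x, hx, hfx⟩

lemma fenchel_le_tangent (hconv : ConvexOn ℝ (Ioi 0) f)
    (hdiff : ∀ t ∈ Ioi (0 : ℝ), HasDerivWithinAt f (f' t) (Ioi 0) t)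
    (hlim : Filter.Tendsto f (nhdsWithin 0 (Ioi 0)) Filter.atTop)
    (hL : 0 < L) (hls : LogSmooth L (Ioi 0) f') {x a p : ℝ} (hx : 0 < x) (hp : f' x = -p)
    (ha : -a ∈ fenchelDom (Ioi 0) f) :
    -fenchel (Ioi 0) f (-a) ≤ -fenchel (Ioi 0) f (-p) + (x - L / p) * (a - p)
      + L * (log a - log p) := by
  have ha0 := pos_of_neg_mem_fenchelDom hconv hdiff hlim hL hls ha
  have hp0 : 0 < p := by linarith [deriv_neg hconv hdiff hlim hL hls hx]
  have hpx : L ≤ p * x := by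
    simpa [hp] using le_neg_deriv_mul hconv hdiff hlim hL hls hx
  have hy : 0 < x + (p / a - 1) * L / p := by
    have : x + (p / a - 1) * L / p = (p * x - L + p / a * L) / p := by field_simp; ring
    rw [this]
    have : 0 < p / a * L := by positivity
    exact div_pos (by linarith) hp0
  have h2 : 1 + -f' x * (x + (p / a - 1) * L / p - x) / L = p / a := by
    rw [hp]; field_simp; ring
  have h1 := le_sub_log hconv hdiff hlim hL hls hx hy (by rw [h2]; positivity)
  rw [h2, log_div hp0.ne' ha0.ne'] at h1
  have h3 := le_csSup ha.2 ⟨_, hy, rfl⟩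
  simp only at h3
  have h4 := (fenchel_le_of_deriv_eq hconv hdiff hx).2
  rw [hp] at h4
  have h5 : (x + (p / a - 1) * L / p) * -a = -(x * a) - L + L / p * a := by field_simp; ring
  have h6 : (x - L / p) * (a - p) = x * a - x * p - L / p * a + L := by field_simp; ring
  rw [h5] at h3
  rw [h6]
  unfold fenchel at h4 ⊢
  linarith

/-- The negated conjugate of a log smooth function minus `L * log` is concave. -/
theorem fenchel_concave (hconv : ConvexOn ℝ (Ioi 0) f)
    (hdiff : ∀ t ∈ Ioi (0 : ℝ), HasDerivWithinAt f (f' t) (Ioi 0) t)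
    (hlim : Filter.Tendsto f (nhdsWithin 0 (Ioi 0)) Filter.atTop)
    (hL : 0 < L) (hls : LogSmooth L (Ioi 0) f') {a b s : ℝ}
    (ha : -a ∈ fenchelDom (Ioi 0) f) (hb : -b ∈ fenchelDom (Ioi 0) f)
    (hs0 : 0 ≤ s) (hs1 : s ≤ 1) :
    -(a + s * (b - a)) ∈ fenchelDom (Ioi 0) f ∧
    (1 - s) * -fenchel (Ioi 0) f (-a) + s * -fenchel (Ioi 0) f (-b)
      + L * (log (a + s * (b - a)) - (1 - s) * log a - s * log b)
      ≤ -fenchel (Ioi 0) f (-(a + s * (b - a))) := by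
  rcases hs0.eq_or_lt with rfl | hs0
  · simp [ha]
  rcases hs1.eq_or_lt with rfl | hs1
  · simp [hb]
  by_cases hab : a = b
  · subst hab
    simp only [sub_self, mul_zero, add_zero]
    exact ⟨ha, by apply le_of_eq; ring⟩
  set p := a + s * (b - a) with hp
  obtain ⟨x, hx, hfx⟩ : ∃ x, 0 < x ∧ f' x = -p := by
    rcases lt_or_gt_of_ne hab with h | h
    · exact exists_deriv_eq_neg hconv hdiff hlim ha (by nlinarith)
    · exact exists_deriv_eq_neg hconv hdiff hlim hb (by nlinarith)
  refine ⟨hfx ▸ (fenchel_le_of_deriv_eq hconv hdiff hx).1, ?_⟩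
  have h1 := mul_le_mul_of_nonneg_left
    (fenchel_le_tangent hconv hdiff hlim hL hls hx hfx ha) (sub_nonneg.2 hs1.le)
  have h2 := mul_le_mul_of_nonneg_left
    (fenchel_le_tangent hconv hdiff hlim hL hls hx hfx hb) hs0.le
  have h3 : (1 - s) * ((x - L / p) * (a - p)) + s * ((x - L / p) * (b - p)) = 0 := by
    rw [hp]; ring
  linarith

theorem fenchel_add_gam_le (hconv : ConvexOn ℝ (Ioi 0) f)
    (hdiff : ∀ t ∈ Ioi (0 : ℝ), HasDerivWithinAt f (f' t) (Ioi 0) t)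
    (hlim : Filter.Tendsto f (nhdsWithin 0 (Ioi 0)) Filter.atTop)
    (hL : 0 < L) (hls : LogSmooth L (Ioi 0) f') {a b s : ℝ}
    (ha : -a ∈ fenchelDom (Ioi 0) f) (hb : -b ∈ fenchelDom (Ioi 0) f)
    (hs0 : 0 < s) (hs1 : s ≤ 1) :
    (1 - s) * -fenchel (Ioi 0) f (-a) + s * -fenchel (Ioi 0) f (-b) + L * (s * gam s a b)
      ≤ -fenchel (Ioi 0) f (-(a + s * (b - a))) := by
  have ha0 := pos_of_neg_mem_fenchelDom hconv hdiff hlim hL hls ha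
  have hb0 := pos_of_neg_mem_fenchelDom hconv hdiff hlim hL hls hb
  obtain ⟨hp, h⟩ := fenchel_concave hconv hdiff hlim hL hls ha hb hs0.le hs1
  have hp0 := pos_of_neg_mem_fenchelDom hconv hdiff hlim hL hls hp
  have h1 : 1 - s + s * (b / a) = (a + s * (b - a)) / a := by field_simp; ring
  have h2 : s * gam s a b = log (a + s * (b - a)) - (1 - s) * log a - s * log b := by
    rw [gam, h1, log_div hp0.ne' ha0.ne', log_div hb0.ne' ha0.ne', mul_sub, ← mul_assoc,
      mul_inv_cancel₀ hs0.ne']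
    ring
  rwa [h2]

lemma log_concave {a b s : ℝ} (ha : 0 < a) (hb : 0 < b) (hs0 : 0 ≤ s) (hs1 : s ≤ 1) :
    (1 - s) * log a + s * log b ≤ log (a + s * (b - a)) := by
  have := strictConcaveOn_log_Ioi.concaveOn.2 ha hb (sub_nonneg.2 hs1) hs0 (by ring)
  simp only [smul_eq_mul] at this
  rwa [show a + s * (b - a) = (1 - s) * a + s * b by ring]

theorem neg_fenchel_concave (hconv : ConvexOn ℝ (Ioi 0) f)
    (hdiff : ∀ t ∈ Ioi (0 : ℝ), HasDerivWithinAt f (f' t) (Ioi 0) t)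
    (hlim : Filter.Tendsto f (nhdsWithin 0 (Ioi 0)) Filter.atTop)
    (hL : 0 < L) (hls : LogSmooth L (Ioi 0) f') {a b s : ℝ}
    (ha : -a ∈ fenchelDom (Ioi 0) f) (hb : -b ∈ fenchelDom (Ioi 0) f)
    (hs0 : 0 ≤ s) (hs1 : s ≤ 1) :
    (1 - s) * -fenchel (Ioi 0) f (-a) + s * -fenchel (Ioi 0) f (-b)
      ≤ -fenchel (Ioi 0) f (-(a + s * (b - a))) := by
  have h := (fenchel_concave hconv hdiff hlim hL hls ha hb hs0 hs1).2
  have h' := log_concave (pos_of_neg_mem_fenchelDom hconv hdiff hlim hL hls ha)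
    (pos_of_neg_mem_fenchelDom hconv hdiff hlim hL hls hb) hs0 hs1
  nlinarith

end LogSmooth

section StrongConvexity

variable {d : ℕ} {g : EuclideanSpace ℝ (Fin d) → ℝ}

/-- A strongly convex function minus a linear form attains its minimum, with quadratic growth. -/
lemma StrongConvexOn.exists_quadratic_growth (hg : StrongConvexOn univ 1 g)
    (v : EuclideanSpace ℝ (Fin d)) :
    ∃ z, ∀ u, ⟪u, v⟫ - g u ≤ ⟪z, v⟫ - g z - 1 / 2 * ‖u - z‖ ^ 2 := by
  have hcont : Continuous g := ((hg.strictConvexOn one_pos).convexOn.locallyLipschitz).continuous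
  set G : EuclideanSpace ℝ (Fin d) → ℝ := fun u => g u - ⟪u, v⟫ with hG
  have hGcont : Continuous G := by fun_prop
  have hGsc : ∀ x y : EuclideanSpace ℝ (Fin d), ∀ a b : ℝ, 0 ≤ a → 0 ≤ b → a + b = 1 →
      G (a • x + b • y) ≤ a * G x + b * G y - a * b * (1 / 2 * ‖x - y‖ ^ 2) := by
    intro x y a b ha hb hab
    have := hg.2 (mem_univ x) (mem_univ y) ha hb hab
    simp only [smul_eq_mul] at this
    simp only [hG, inner_add_left, real_inner_smul_left]
    linarith
  obtain ⟨w, -, hw⟩ := (isCompact_closedBall (0 : EuclideanSpace ℝ (Fin d)) 1).exists_isMinOn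
    ⟨0, by simp⟩ hGcont.continuousOn
  have hw : ∀ u, ‖u‖ ≤ 1 → G w ≤ G u := fun u hu => hw (by simpa using hu)
  obtain ⟨z, hz⟩ : ∃ z, ∀ u, G z ≤ G u := by
    refine hGcont.exists_forall_le' 0 ?_
    filter_upwards [tendsto_norm_cocompact_atTop.eventually_ge_atTop (1 + 2 * (G 0 - G w))]
      with u hu
    have hw0 := hw 0 (by simp)
    have hr : 1 ≤ ‖u‖ := by linarith
    have hr0 : 0 < ‖u‖ := by linarith
    have h1 := hGsc u 0 (1 / ‖u‖) (1 - 1 / ‖u‖) (by positivity)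
      (by rw [sub_nonneg, div_le_one hr0]; exact hr) (by ring)
    have h2 := hw ((1 / ‖u‖) • u + (1 - 1 / ‖u‖) • 0) (by
      simp [norm_smul, hr0.ne'])
    have h3 := mul_le_mul_of_nonneg_left (h2.trans h1) hr0.le
    have h4 : ‖u‖ * (1 / ‖u‖ * G u + (1 - 1 / ‖u‖) * G 0
        - 1 / ‖u‖ * (1 - 1 / ‖u‖) * (1 / 2 * ‖u - 0‖ ^ 2))
        = G u + (‖u‖ - 1) * G 0 - 1 / 2 * (‖u‖ * (‖u‖ - 1)) := by
      rw [sub_zero]; field_simp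
    rw [h4] at h3
    nlinarith
  refine ⟨z, fun u => ?_⟩
  suffices h : ∀ t : ℝ, 0 < t → t < 1 → G z + (1 - t) * (1 / 2 * ‖u - z‖ ^ 2) ≤ G u by
    have hlim : Filter.Tendsto (fun t : ℝ => G z + (1 - t) * (1 / 2 * ‖u - z‖ ^ 2))
        (nhdsWithin 0 (Ioi 0)) (nhds (G z + (1 - 0) * (1 / 2 * ‖u - z‖ ^ 2))) :=
      (Continuous.tendsto (by fun_prop) 0).mono_left nhdsWithin_le_nhds
    have := le_of_tendsto hlim (by
      filter_upwards [Ioo_mem_nhdsGT one_pos] with t ht using h t ht.1 ht.2)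
    simp only [hG] at this
    linarith
  intro t ht0 ht1
  have h1 := (hz _).trans (hGsc u z t (1 - t) ht0.le (by linarith) (by ring))
  have h2 : t * (G z + (1 - t) * (1 / 2 * ‖u - z‖ ^ 2)) ≤ t * G u := by linarith
  exact le_of_mul_le_mul_left h2 ht0

/-- The conjugate of a `1`-strongly convex function is convex and `1`-smooth: at each `v` it has a
subgradient `z` for which the quadratic upper bound holds. -/
theorem StrongConvexOn.exists_fenchelE_bounds (hg : StrongConvexOn univ 1 g)
    (v : EuclideanSpace ℝ (Fin d)) :
    ∃ z, ∀ w, fenchelE g v + ⟪z, w⟫ ≤ fenchelE g (v + w) ∧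
      fenchelE g (v + w) ≤ fenchelE g v + ⟪z, w⟫ + 1 / 2 * ‖w‖ ^ 2 := by
  obtain ⟨z, hz⟩ := hg.exists_quadratic_growth v
  have hv : fenchelE g v = ⟪z, v⟫ - g z := by
    refine le_antisymm (ciSup_le fun u => ?_)
      (le_ciSup (f := fun u => ⟪u, v⟫ - g u) ⟨⟪z, v⟫ - g z, ?_⟩ z)
    · linarith [hz u, sq_nonneg ‖u - z‖]
    · rintro _ ⟨u, rfl⟩
      linarith [hz u, sq_nonneg ‖u - z‖]
  refine ⟨z, fun w => ?_⟩
  have hub : ∀ u, ⟪u, v + w⟫ - g u ≤ fenchelE g v + ⟪z, w⟫ + 1 / 2 * ‖w‖ ^ 2 := fun u => by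
    have h1 : (0 : ℝ) ≤ ‖(u - z) - w‖ ^ 2 := sq_nonneg _
    rw [norm_sub_sq_real, inner_sub_left] at h1
    rw [inner_add_right, hv]
    linarith [hz u]
  refine ⟨?_, ciSup_le hub⟩
  have := le_ciSup (f := fun u => ⟪u, v + w⟫ - g u) ⟨_, by rintro _ ⟨u, rfl⟩; exact hub u⟩ z
  rw [inner_add_right] at this
  rw [hv]
  exact le_trans (by linarith) this

theorem StrongConvexOn.fenchelE_convex (hg : StrongConvexOn univ 1 g)
    (v w : EuclideanSpace ℝ (Fin d)) {s : ℝ} (hs0 : 0 ≤ s) (hs1 : s ≤ 1) :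
    fenchelE g (v + s • (w - v)) ≤ (1 - s) * fenchelE g v + s * fenchelE g w := by
  obtain ⟨z, hz⟩ := hg.exists_fenchelE_bounds (v + s • (w - v))
  have h1 := (hz (-s • (w - v))).1
  have h2 := (hz ((1 - s) • (w - v))).1
  rw [show v + s • (w - v) + -s • (w - v) = v by module] at h1
  rw [show v + s • (w - v) + (1 - s) • (w - v) = w by module] at h2
  rw [real_inner_smul_right] at h1 h2
  linarith [mul_le_mul_of_nonneg_left h1 (sub_nonneg.2 hs1), mul_le_mul_of_nonneg_left h2 hs0]

end StrongConvexity

section CoordinateAscent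

variable {d : ℕ}

/-- The dual objective along one coordinate, as a function of the new value `a` of the coordinate,
up to terms that do not depend on `a`. -/
noncomputable def coordDual (f : ℝ → ℝ) (g : EuclideanSpace ℝ (Fin d) → ℝ) (lam N : ℝ)
    (v x : EuclideanSpace ℝ (Fin d)) (a₀ a : ℝ) : ℝ :=
  -(1 / N) * fenchel (Ioi 0) f (-a) - lam * fenchelE g (v + (1 / (lam * N)) • ((a - a₀) • x))

variable {f f' : ℝ → ℝ} {L : ℝ} {g : EuclideanSpace ℝ (Fin d) → ℝ} {lam N : ℝ}
  {v x : EuclideanSpace ℝ (Fin d)} {a₀ : ℝ}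

lemma coordDual_concave (hconv : ConvexOn ℝ (Ioi 0) f)
    (hdiff : ∀ t ∈ Ioi (0 : ℝ), HasDerivWithinAt f (f' t) (Ioi 0) t)
    (hlim : Filter.Tendsto f (nhdsWithin 0 (Ioi 0)) Filter.atTop)
    (hL : 0 < L) (hls : LogSmooth L (Ioi 0) f') (hg : StrongConvexOn univ 1 g)
    (hlam : 0 < lam) (hN : 0 < N) {a b s : ℝ}
    (ha : -a ∈ fenchelDom (Ioi 0) f) (hb : -b ∈ fenchelDom (Ioi 0) f)
    (hs0 : 0 ≤ s) (hs1 : s ≤ 1) :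
    (1 - s) * coordDual f g lam N v x a₀ a + s * coordDual f g lam N v x a₀ b
      ≤ coordDual f g lam N v x a₀ (a + s * (b - a)) := by
  have h1 := mul_le_mul_of_nonneg_left
    (LogSmooth.neg_fenchel_concave hconv hdiff hlim hL hls ha hb hs0 hs1) (one_div_pos.2 hN).le
  have h2 := mul_le_mul_of_nonneg_left (hg.fenchelE_convex (v + (1 / (lam * N)) • ((a - a₀) • x))
    (v + (1 / (lam * N)) • ((b - a₀) • x)) hs0 hs1) hlam.le
  rw [show v + (1 / (lam * N)) • ((a - a₀) • x) + s • (v + (1 / (lam * N)) • ((b - a₀) • x)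
    - (v + (1 / (lam * N)) • ((a - a₀) • x)))
    = v + (1 / (lam * N)) • ((a + s * (b - a) - a₀) • x) by module] at h2
  unfold coordDual
  linarith

/-- Clipping the maximizer `c` at `β` does no worse than any point below `β`. -/
lemma coordDual_le_clip (hconv : ConvexOn ℝ (Ioi 0) f)
    (hdiff : ∀ t ∈ Ioi (0 : ℝ), HasDerivWithinAt f (f' t) (Ioi 0) t)
    (hlim : Filter.Tendsto f (nhdsWithin 0 (Ioi 0)) Filter.atTop)
    (hL : 0 < L) (hls : LogSmooth L (Ioi 0) f') (hg : StrongConvexOn univ 1 g)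
    (hlam : 0 < lam) (hN : 0 < N) {β c q : ℝ} (hc : -c ∈ fenchelDom (Ioi 0) f)
    (hmax : ∀ a, -a ∈ fenchelDom (Ioi 0) f →
      coordDual f g lam N v x a₀ a ≤ coordDual f g lam N v x a₀ c)
    (hq : -q ∈ fenchelDom (Ioi 0) f) (hqβ : q ≤ β) :
    coordDual f g lam N v x a₀ q ≤ coordDual f g lam N v x a₀ (c * min 1 (β / c)) := by
  have hc0 := LogSmooth.pos_of_neg_mem_fenchelDom hconv hdiff hlim hL hls hc
  rw [mul_min_of_nonneg _ _ hc0.le, mul_one, mul_div_cancel₀ _ hc0.ne']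
  rcases le_total c β with h | h
  · rw [min_eq_left h]
    exact hmax q hq
  rw [min_eq_right h]
  rcases hqβ.eq_or_lt with rfl | hlt
  · rfl
  have hqc : 0 < c - q := by linarith
  have hs1 : (β - q) / (c - q) ≤ 1 := by rw [div_le_one hqc]; linarith
  have hs0 : 0 ≤ (β - q) / (c - q) := div_nonneg (by linarith) hqc.le
  have h1 := coordDual_concave (v := v) (x := x) (a₀ := a₀) hconv hdiff hlim hL hls hg hlam hN
    hq hc hs0 hs1
  rw [div_mul_cancel₀ _ hqc.ne', add_sub_cancel] at h1
  linarith [mul_le_mul_of_nonneg_left (hmax q hq) hs0]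

/-- Progress of one shifted coordinate update. -/
theorem coordDual_clip_sub_ge (hconv : ConvexOn ℝ (Ioi 0) f)
    (hdiff : ∀ t ∈ Ioi (0 : ℝ), HasDerivWithinAt f (f' t) (Ioi 0) t)
    (hlim : Filter.Tendsto f (nhdsWithin 0 (Ioi 0)) Filter.atTop)
    (hL : 0 < L) (hls : LogSmooth L (Ioi 0) f') (hg : StrongConvexOn univ 1 g)
    (hlam : 0 < lam) (hN : 0 < N) {z : EuclideanSpace ℝ (Fin d)}
    (hz : ∀ w, fenchelE g (v + w) ≤ fenchelE g v + ⟪z, w⟫ + 1 / 2 * ‖w‖ ^ 2)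
    {b β c s : ℝ} (ha : -a₀ ∈ fenchelDom (Ioi 0) f) (hb : -b ∈ fenchelDom (Ioi 0) f)
    (haβ : 1 ≤ β / a₀) (hbβ : 1 ≤ β / b) (hc : -c ∈ fenchelDom (Ioi 0) f)
    (hmax : ∀ a, -a ∈ fenchelDom (Ioi 0) f →
      coordDual f g lam N v x a₀ a ≤ coordDual f g lam N v x a₀ c)
    (hs0 : 0 < s) (hs1 : s ≤ 1) :
    1 / N * (-fenchel (Ioi 0) f (-b) - -fenchel (Ioi 0) f (-a₀)) - 1 / N * ((b - a₀) * ⟪z, x⟫)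
      + 1 / N * (L * gam s a₀ b - s / (2 * lam * N) * ‖x‖ ^ 2 * (b - a₀) ^ 2)
      ≤ s⁻¹ * (coordDual f g lam N v x a₀ (c * min 1 (β / c)) - coordDual f g lam N v x a₀ a₀) := by
  have ha0 := LogSmooth.pos_of_neg_mem_fenchelDom hconv hdiff hlim hL hls ha
  have hb0 := LogSmooth.pos_of_neg_mem_fenchelDom hconv hdiff hlim hL hls hb
  rw [one_le_div ha0] at haβ
  rw [one_le_div hb0] at hbβ
  have hq := (LogSmooth.fenchel_concave hconv hdiff hlim hL hls ha hb hs0.le hs1).1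
  have h1 := coordDual_le_clip hconv hdiff hlim hL hls hg hlam hN hc hmax hq
    (β := β) (by nlinarith)
  have h2 := mul_le_mul_of_nonneg_left
    (LogSmooth.fenchel_add_gam_le hconv hdiff hlim hL hls ha hb hs0 hs1) (one_div_pos.2 hN).le
  have h3 := mul_le_mul_of_nonneg_left
    (hz ((1 / (lam * N)) • ((a₀ + s * (b - a₀) - a₀) • x))) hlam.le
  rw [le_inv_mul_iff₀ hs0]
  refine le_trans ?_ (sub_le_sub_right h1 _)
  have h4 : lam * (fenchelE g v + ⟪z, (1 / (lam * N)) • ((a₀ + s * (b - a₀) - a₀) • x)⟫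
      + 1 / 2 * ‖(1 / (lam * N)) • ((a₀ + s * (b - a₀) - a₀) • x)‖ ^ 2)
      = lam * fenchelE g v + s * (1 / N * ((b - a₀) * ⟪z, x⟫))
        + s * (1 / N * (s / (2 * lam * N) * ‖x‖ ^ 2 * (b - a₀) ^ 2)) := by
    rw [smul_smul, real_inner_smul_right, norm_smul, mul_pow, norm_eq_abs, sq_abs]
    field_simp
    ring
  rw [h4] at h3
  simp only [coordDual, sub_self, zero_smul, smul_zero, add_zero]
  linarith

end CoordinateAscent

/-- key lemma for shifted SDCA, Lemma 7: with `α^{(t,i)}` the result of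
the shifted SDCA update at coordinate `i` from `α^{(t−1)}`, for any `s_i ∈ (0, 1]`,
`∑_i s_i⁻¹(D(α^{(t,i)}) − D(α^{(t−1)})) ≥ D(α*) − D(α^{(t−1)})
  + (1/n)·∑_i (L_i·γ(s_i, α_i^{(t−1)}, α_i*) − (s_i/(2λn))·‖x_i‖²·(α_i* − α_i^{(t−1)})²)`. -/
theorem shifted_sdca_key_lemma
    (d n : ℕ) (hn : 0 < n)
    (ψ : EuclideanSpace ℝ (Fin d)) (x : Fin n → EuclideanSpace ℝ (Fin d))
    (lam : ℝ) (hlam : 0 < lam)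
    (f f' : Fin n → ℝ → ℝ) (L : Fin n → ℝ) (hL : ∀ i, 0 < L i)
    (hconv : ∀ i, ConvexOn ℝ (Ioi 0) (f i))
    (hdiff : ∀ i, ∀ t ∈ Ioi (0:ℝ), HasDerivWithinAt (f i) (f' i t) (Ioi 0) t)
    (hlim : ∀ i, Filter.Tendsto (f i) (nhdsWithin 0 (Ioi 0)) Filter.atTop)
    (hls : ∀ i, LogSmooth (L i) (Ioi 0) (f' i))
    (hconjdiff : ∀ i, DifferentiableOn ℝ (fenchel (Ioi 0) (f i))
      (fenchelDom (Ioi 0) (f i)))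
    (g : EuclideanSpace ℝ (Fin d) → ℝ) (hg : StrongConvexOn univ 1 g)
    (Ddual : (Fin n → ℝ) → ℝ)
    (hD : Ddual = fun α => (1 / (n : ℝ)) * ∑ i, -(fenchel (Ioi 0) (f i) (-(α i)))
        - lam * fenchelE g ((1 / (lam * n)) • ∑ i, α i • x i - (1 / lam) • ψ))
    -- the dual maximizer α*
    (αstar : Fin n → ℝ)
    (hαstardom : ∀ i, -(αstar i) ∈ fenchelDom (Ioi 0) (f i))
    (hαstar : ∀ α : Fin n → ℝ, (∀ i, -(α i) ∈ fenchelDom (Ioi 0) (f i)) →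
      Ddual α ≤ Ddual αstar)
    -- bounds β with β_i/α_i* ≥ 1
    (β : Fin n → ℝ) (hβdom : ∀ i, -(β i) ∈ fenchelDom (Ioi 0) (f i))
    (hβ : ∀ i, 1 ≤ β i / αstar i)
    -- the previous iterate
    (αprev : Fin n → ℝ)
    (hαprevdom : ∀ i, -(αprev i) ∈ fenchelDom (Ioi 0) (f i))
    (hαprev : ∀ i, 1 ≤ β i / αprev i)
    -- α^{(t,i)} : the result of the shifted SDCA update for coordinate i
    (A : Fin n → Fin n → ℝ)
    (hA : ∀ i, ∃ c : ℝ, -c ∈ fenchelDom (Ioi 0) (f i) ∧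
      (∀ a : ℝ, -a ∈ fenchelDom (Ioi 0) (f i) →
        -(1 / (n : ℝ)) * fenchel (Ioi 0) (f i) (-a) -
          lam * fenchelE g (((1 / (lam * n)) • ∑ j, αprev j • x j - (1 / lam) • ψ) +
            (1 / (lam * n)) • ((a - αprev i) • x i))
        ≤ -(1 / (n : ℝ)) * fenchel (Ioi 0) (f i) (-c) -
          lam * fenchelE g (((1 / (lam * n)) • ∑ j, αprev j • x j - (1 / lam) • ψ) +
            (1 / (lam * n)) • ((c - αprev i) • x i))) ∧
      A i = Function.update αprev i (c * min 1 (β i / c))) :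
    ∀ s : Fin n → ℝ, (∀ i, s i ∈ Ioc (0:ℝ) 1) →
      ∑ i, (s i)⁻¹ * (Ddual (A i) - Ddual αprev)
        ≥ Ddual αstar - Ddual αprev +
          (1 / (n : ℝ)) * ∑ i, (L i * gam (s i) (αprev i) (αstar i) -
            s i / (2 * lam * n) * ‖x i‖ ^ 2 * (αstar i - αprev i) ^ 2) := by
  intro s hs
  have hN : (0 : ℝ) < n := Nat.cast_pos.2 hn
  set v := (1 / (lam * (n : ℝ))) • ∑ j, αprev j • x j - (1 / lam) • ψ with hv
  obtain ⟨z, hz⟩ := hg.exists_fenchelE_bounds v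
  have hcoord : ∀ i t, Ddual (Function.update αprev i t) - Ddual αprev
      = coordDual (f i) g lam n v (x i) (αprev i) t
        - coordDual (f i) g lam n v (x i) (αprev i) (αprev i) := by
    intro i t
    have hsum : ∑ j, Function.update αprev i t j • x j
        = ∑ j, αprev j • x j + (t - αprev i) • x i := by
      rw [sum_apply_update (fun j r => r • x j), sub_smul]
    have hsum' : ∑ j, -fenchel (Ioi 0) (f j) (-Function.update αprev i t j)
        = ∑ j, -fenchel (Ioi 0) (f j) (-αprev j)
          + (-fenchel (Ioi 0) (f i) (-t) - -fenchel (Ioi 0) (f i) (-αprev i)) :=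
      sum_apply_update (fun j r => -fenchel (Ioi 0) (f j) (-r)) αprev i t
    simp only [hD, coordDual, hsum, hsum', sub_self, zero_smul, smul_zero, add_zero]
    rw [smul_add, add_sub_right_comm, ← hv]
    ring
  have hstep : ∀ i, _ ≤ (s i)⁻¹ * (Ddual (A i) - Ddual αprev) := fun i => by
    obtain ⟨c, hc, hmax, hAi⟩ := hA i
    rw [hAi, hcoord]
    exact coordDual_clip_sub_ge (hconv i) (hdiff i) (hlim i) (hL i) (hls i) hg hlam hN
      (fun w => (hz w).2) (hαprevdom i) (hαstardom i) (hαprev i) (hβ i) hc hmax (hs i).1 (hs i).2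
  refine ge_iff_le.2 (le_trans ?_ (sum_le_sum fun i _ => hstep i))
  have hstar := (hz ((1 / (lam * (n : ℝ))) • ∑ i, (αstar i - αprev i) • x i)).1
  have hvstar : v + (1 / (lam * (n : ℝ))) • ∑ i, (αstar i - αprev i) • x i
      = (1 / (lam * (n : ℝ))) • ∑ i, αstar i • x i - (1 / lam) • ψ := by
    simp only [sub_smul, sum_sub_distrib, hv]
    module
  have hinner : lam * ⟪z, (1 / (lam * (n : ℝ))) • ∑ i, (αstar i - αprev i) • x i⟫
      = 1 / (n : ℝ) * ∑ i, (αstar i - αprev i) * ⟪z, x i⟫ := by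
    simp only [real_inner_smul_right, inner_sum]
    field_simp
  rw [hvstar] at hstar
  have hstar := mul_le_mul_of_nonneg_left hstar hlam.le
  rw [mul_add, hinner] at hstar
  simp only [sum_add_distrib, sum_sub_distrib, ← mul_sum, hD, ← hv] at hstar ⊢
  linarith
end

section
/- Let y > 0, λ > 0, n a positive integer, x ∈ ℝ^d with x ≠ 0, w ∈ ℝ^d and α₀ ∈ ℝ. The concave function φ : (0, ∞) → ℝ defined by φ(a) = (1/n)·(y + y·log(a/y)) − (λ/2)·‖w + (λn)^{−1}·(a − α₀)·x‖² attains its maximum over (0, ∞) at the unique point a⁺ = (1/2)·( √( (α₀ − (λn/‖x‖²)·xᵀw)² + 4λn·y/‖x‖² ) + α₀ − (λn/‖x‖²)·xᵀw ), which is the unique positive root of the equation y/a − xᵀw − (‖x‖²/(λn))·(a − α₀) = 0. -/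
open Real Set Finset
open scoped RealInnerProductSpace

/-- Expansion of the regularizing term of the local dual objective. -/
theorem half_mul_norm_add_smul_sq {E : Type*} [NormedAddCommGroup E] [InnerProductSpace ℝ E]
    (x w : E) {c : ℝ} (hc : c ≠ 0) (t : ℝ) :
    c / 2 * ‖w + (c⁻¹ * t) • x‖ ^ 2 =
      c / 2 * ‖w‖ ^ 2 + ⟪x, w⟫ * t + ‖x‖ ^ 2 / (2 * c) * t ^ 2 := by
  rw [norm_add_sq_real, inner_smul_right, norm_smul, mul_pow, Real.norm_eq_abs, sq_abs,
    real_inner_comm]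
  field_simp

theorem concaveOn_log_sub_quadratic {y k : ℝ} (hy : 0 ≤ y) (hk : 0 ≤ k) (p α : ℝ) :
    ConcaveOn ℝ (Ioi 0) fun a => y * Real.log a - p * (a - α) - k * (a - α) ^ 2 := by
  refine ⟨convex_Ioi 0, fun a ha b hb u v hu hv huv => ?_⟩
  have hlog := mul_le_mul_of_nonneg_left
    (strictConcaveOn_log_Ioi.concaveOn.2 ha hb hu hv huv) hy
  obtain rfl : v = 1 - u := by linarith
  have hsq : 0 ≤ k * (u * (1 - u) * (a - b) ^ 2) := by positivity
  simp only [smul_eq_mul] at hlog ⊢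
  linear_combination hlog + hsq

/-- Quadratic growth of the objective away from a positive stationary point `b`. -/
theorem log_sub_quadratic_add_le {y p k α a b : ℝ} (hy : 0 ≤ y) (ha : 0 < a) (hb : 0 < b)
    (hroot : y / b - p - 2 * k * (b - α) = 0) :
    y * Real.log a - p * (a - α) - k * (a - α) ^ 2 + k * (a - b) ^ 2 ≤
      y * Real.log b - p * (b - α) - k * (b - α) ^ 2 := by
  have hlog := mul_le_mul_of_nonneg_left (Real.log_le_sub_one_of_pos (div_pos ha hb)) hy
  rw [Real.log_div ha.ne' hb.ne'] at hlog
  have hdiv : y * (a / b - 1) = y / b * (a - b) := by field_simp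
  rw [hdiv] at hlog
  linear_combination hlog + (a - b) * hroot

/-- The larger root of `a ^ 2 - m * a - q` is positive when `q` is. -/
theorem quadratic_root_pos_and_eq {m q : ℝ} (hq : 0 < q) :
    0 < 1 / 2 * (√(m ^ 2 + 4 * q) + m) ∧
      (1 / 2 * (√(m ^ 2 + 4 * q) + m)) ^ 2 = m * (1 / 2 * (√(m ^ 2 + 4 * q) + m)) + q := by
  have hsq := Real.sq_sqrt (show 0 ≤ m ^ 2 + 4 * q by positivity)
  have habs : |m| < √(m ^ 2 + 4 * q) := by
    rw [← Real.sqrt_sq_eq_abs]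
    exact Real.sqrt_lt_sqrt (sq_nonneg m) (by linarith)
  refine ⟨?_, by linear_combination hsq / 4⟩
  linarith [neg_abs_le m]

/-- Proposition 4, closed-form local maximization step: the concave
function `φ(a) = (1/n)(y + y·log(a/y)) − (λ/2)‖w + (λn)⁻¹(a − α₀)x‖²` on `(0, ∞)`
attains its maximum at the unique point `a⁺` given in closed form, which is the unique
positive root of `y/a − xᵀw − (‖x‖²/(λn))(a − α₀) = 0`. -/
theorem sdca_closed_form_update
    (d : ℕ) (y lam : ℝ) (hy : 0 < y) (hlam : 0 < lam) (n : ℕ) (hn : 0 < n)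
    (x w : EuclideanSpace ℝ (Fin d)) (hx : x ≠ 0) (α₀ : ℝ)
    (φ : ℝ → ℝ)
    (hφ : φ = fun a => (1 / (n : ℝ)) * (y + y * Real.log (a / y)) -
      lam / 2 * ‖w + ((lam * n)⁻¹ * (a - α₀)) • x‖ ^ 2)
    (aplus : ℝ)
    (haplus : aplus = 1 / 2 *
      (Real.sqrt ((α₀ - lam * n / ‖x‖ ^ 2 * ⟪x, w⟫) ^ 2 + 4 * lam * n * y / ‖x‖ ^ 2)
        + α₀ - lam * n / ‖x‖ ^ 2 * ⟪x, w⟫)) :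
    ConcaveOn ℝ (Ioi 0) φ ∧
    aplus ∈ Ioi (0:ℝ) ∧
    (∀ a ∈ Ioi (0:ℝ), φ a ≤ φ aplus) ∧
    (∀ a ∈ Ioi (0:ℝ), (∀ b ∈ Ioi (0:ℝ), φ b ≤ φ a) → a = aplus) ∧
    (y / aplus - ⟪x, w⟫ - ‖x‖ ^ 2 / (lam * n) * (aplus - α₀) = 0) ∧
    (∀ a ∈ Ioi (0:ℝ), y / a - ⟪x, w⟫ - ‖x‖ ^ 2 / (lam * n) * (a - α₀) = 0 →
      a = aplus) := by
  have hn' : (0 : ℝ) < n := Nat.cast_pos.mpr hn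
  have hx' : 0 < ‖x‖ := norm_pos_iff.mpr hx
  have hc : 0 < lam * n := mul_pos hlam hn'
  set p : ℝ := ⟪x, w⟫ with hp
  set k : ℝ := ‖x‖ ^ 2 / (2 * (lam * n)) with hk
  have hkpos : 0 < k := by positivity
  have hk2 : ‖x‖ ^ 2 / (lam * n) = 2 * k := by rw [hk]; field_simp
  set F : ℝ → ℝ := fun a => y * Real.log a - p * (a - α₀) - k * (a - α₀) ^ 2 with hF
  set C : ℝ := y - y * Real.log y - lam * n / 2 * ‖w‖ ^ 2 with hC
  have hφF : ∀ a ∈ Ioi (0 : ℝ), φ a = (n : ℝ)⁻¹ * (F a + C) := by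
    intro a ha
    have hexp := half_mul_norm_add_smul_sq x w hc.ne' (a - α₀)
    rw [hφ, eq_inv_mul_iff_mul_eq₀ hn'.ne']
    simp only [hF, hC, Real.log_div (ne_of_gt ha) hy.ne']
    have hone : (n : ℝ) * (1 / n) = 1 := by field_simp
    linear_combination (y + y * (Real.log a - Real.log y)) * hone - hexp
  have hgrowth : ∀ a ∈ Ioi (0 : ℝ), ∀ b ∈ Ioi (0 : ℝ),
      y / b - p - 2 * k * (b - α₀) = 0 → F a + k * (a - b) ^ 2 ≤ F b :=
    fun a ha b hb hroot => log_sub_quadratic_add_le hy.le ha hb hroot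
  have hle : ∀ a ∈ Ioi (0 : ℝ), ∀ b ∈ Ioi (0 : ℝ), φ a ≤ φ b ↔ F a ≤ F b := by
    intro a ha b hb
    rw [hφF a ha, hφF b hb, mul_le_mul_iff_right₀ (inv_pos.mpr hn'), add_le_add_iff_right]
  have huniq : ∀ a ∈ Ioi (0 : ℝ), ∀ b ∈ Ioi (0 : ℝ),
      y / b - p - 2 * k * (b - α₀) = 0 → F b ≤ F a → a = b := by
    intro a ha b hb hroot hba
    have hzero : k * (a - b) ^ 2 ≤ 0 := by linarith [hgrowth a ha b hb hroot]
    have : (a - b) ^ 2 = 0 :=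
      le_antisymm (nonpos_of_mul_nonpos_right hzero hkpos) (sq_nonneg _)
    exact sub_eq_zero.mp (pow_eq_zero_iff two_ne_zero |>.mp this)
  obtain ⟨hpos, hquad⟩ := quadratic_root_pos_and_eq
    (m := α₀ - lam * n / ‖x‖ ^ 2 * p) (q := lam * n * y / ‖x‖ ^ 2) (by positivity)
  have haplus' : aplus = 1 / 2 * (√((α₀ - lam * n / ‖x‖ ^ 2 * p) ^ 2 +
      4 * (lam * n * y / ‖x‖ ^ 2)) + (α₀ - lam * n / ‖x‖ ^ 2 * p)) := by
    rw [haplus, add_sub_assoc]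
    congr 4
    ring
  rw [← haplus'] at hpos hquad
  have hroot : y / aplus - p - 2 * k * (aplus - α₀) = 0 := by
    rw [← hk2]
    field_simp at hquad ⊢
    linear_combination -hquad
  rw [hk2]
  refine ⟨?_, hpos, fun a ha => ?_, fun a ha hmax => ?_, hroot, fun a ha hroot' => ?_⟩
  · refine ConcaveOn.congr (((concaveOn_log_sub_quadratic hy.le hkpos.le p α₀).add_const C).smul
      (inv_pos.mpr hn').le) fun a ha => ?_
    exact (hφF a ha).symm
  · rw [hle a ha aplus hpos]
    exact (le_add_of_nonneg_right (by positivity)).trans (hgrowth a ha aplus hpos hroot)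
  · exact huniq a ha aplus hpos hroot ((hle aplus hpos a ha).mp (hmax aplus hpos))
  · exact huniq a ha aplus hpos hroot
      ((le_add_of_nonneg_right (by positivity)).trans (hgrowth aplus hpos a ha hroot'))
end

section
/- Let λ > 0, n a positive integer, ψ, x_1, …, x_n ∈ ℝ^d with x_i ≠ 0 and x_iᵀx_j ≥ 0 for all 1 ≤ i, j ≤ n, and y_1, …, y_n > 0. If α ∈ (0, ∞)^n satisfies, for every i, α_i·( ∑_{j=1}^n α_j·x_jᵀx_i − n·ψᵀx_i ) = λ·n·y_i, then for every i, α_i ≤ β_i, where β_i = (1/(2‖x_i‖²))·( n·ψᵀx_i + √( (n·ψᵀx_i)² + 4λn·y_i·‖x_i‖² ) ). -/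
open Real Set Finset
open scoped RealInnerProductSpace

/-- A solution of the quadratic inequality `s a² - b a ≤ c` with `s > 0` is at most the larger
root of `s a² - b a = c`. -/
theorem le_of_mul_sq_sub_le {a b c s D : ℝ} (hs : 0 < s) (h : s * a ^ 2 - b * a ≤ c)
    (hD : D = b ^ 2 + 4 * c * s) : a ≤ 1 / (2 * s) * (b + √D) := by
  have hsqrt : 2 * s * a - b ≤ √D :=
    Real.le_sqrt_of_sq_le (by nlinarith [mul_le_mul_of_nonneg_left h hs.le])
  rw [one_div_mul_eq_div, le_div_iff₀ (by positivity)]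
  linarith

/-- Proposition 5, bounds on the dual variables at the optimum: if
`α ∈ (0, ∞)^n` satisfies the fixed-point equations
`α_i(∑_j α_j x_jᵀx_i − nψᵀx_i) = λny_i` and the inner products `x_iᵀx_j` are
nonnegative, then `α_i ≤ β_i = (nψᵀx_i + √((nψᵀx_i)² + 4λny_i‖x_i‖²))/(2‖x_i‖²)`. -/
theorem dual_variables_upper_bound
    (d n : ℕ) (hn : 0 < n) (lam : ℝ) (hlam : 0 < lam)
    (ψ : EuclideanSpace ℝ (Fin d)) (x : Fin n → EuclideanSpace ℝ (Fin d))
    (hx : ∀ i, x i ≠ 0)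
    (hxx : ∀ i j, 0 ≤ ⟪x i, x j⟫)
    (y : Fin n → ℝ) (hy : ∀ i, 0 < y i)
    (α : Fin n → ℝ) (hα : ∀ i, 0 < α i)
    (heq : ∀ i, α i * (∑ j, α j * ⟪x j, x i⟫ - n * ⟪ψ, x i⟫) = lam * n * y i) :
    ∀ i, α i ≤ 1 / (2 * ‖x i‖ ^ 2) *
      (n * ⟪ψ, x i⟫ +
        Real.sqrt ((n * ⟪ψ, x i⟫) ^ 2 + 4 * lam * n * y i * ‖x i‖ ^ 2)) := by
  intro i
  have hs : 0 < ‖x i‖ ^ 2 := pow_pos (norm_pos_iff.mpr (hx i)) 2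
  have hsum : α i * ‖x i‖ ^ 2 ≤ ∑ j, α j * ⟪x j, x i⟫ := by
    rw [← real_inner_self_eq_norm_sq]
    exact Finset.single_le_sum (f := fun j => α j * ⟪x j, x i⟫)
      (fun j _ => mul_nonneg (hα j).le (hxx j i)) (Finset.mem_univ i)
  exact le_of_mul_sq_sub_le hs (c := lam * n * y i)
    (by nlinarith [mul_le_mul_of_nonneg_left hsum (hα i).le, heq i])
    (by ring)
end

section
/- Let λ > 0, n a positive integer, ψ, x_1, …, x_n ∈ ℝ^d with x_i ≠ 0 and x_iᵀx_j ≥ 0 for all 1 ≤ i, j ≤ n, and y_1, …, y_n > 0. Fix i and let α ∈ [0, ∞)^n, and set w = (1/(λn))·∑_{j=1}^n α_j·x_j − ψ/λ. Then the closed-form SDCA update a⁺ = (1/2)·( √( (α_i − (λn/‖x_i‖²)·x_iᵀw)² + 4λn·y_i/‖x_i‖² ) + α_i − (λn/‖x_i‖²)·x_iᵀw ) satisfies a⁺ ≤ β_i, where β_i = (1/(2‖x_i‖²))·( n·ψᵀx_i + √( (n·ψᵀx_i)² + 4λn·y_i·‖x_i‖² ) ). -/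
open Real Set Finset
open scoped RealInnerProductSpace

/-- The map `t ↦ √(t² + c) + t` is monotone for `c ≥ 0`. -/
theorem monotone_sqrt_sq_add_add_self {c : ℝ} (hc : 0 ≤ c) :
    Monotone fun t : ℝ => √(t ^ 2 + c) + t := by
  intro t s hts
  have hle : -s ≤ √(s ^ 2 + c) :=
    (neg_le_abs s).trans (Real.abs_le_sqrt (by linarith))
  have hsq : √(s ^ 2 + c) ^ 2 = s ^ 2 + c := Real.sq_sqrt (by positivity)
  have key : √(t ^ 2 + c) ≤ √(s ^ 2 + c) + (s - t) := by
    refine Real.sqrt_le_iff.mpr ⟨by linarith [Real.sqrt_nonneg (s ^ 2 + c)], ?_⟩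
    nlinarith [mul_nonneg (sub_nonneg.mpr hts) (by linarith : 0 ≤ √(s ^ 2 + c) + s)]
  change √(t ^ 2 + c) + t ≤ √(s ^ 2 + c) + s
  linarith

/-- Remark 2, the closed-form update never exceeds the generic bound:
with `w = (1/(λn))∑_j α_j x_j − ψ/λ` for `α ∈ [0, ∞)^n` and nonnegative inner products
`x_iᵀx_j`, the closed-form SDCA update `a⁺` for coordinate `i` satisfies `a⁺ ≤ β_i`. -/
theorem closed_form_update_bounded
    (d n : ℕ) (hn : 0 < n) (lam : ℝ) (hlam : 0 < lam)
    (ψ : EuclideanSpace ℝ (Fin d)) (x : Fin n → EuclideanSpace ℝ (Fin d))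
    (hx : ∀ i, x i ≠ 0)
    (hxx : ∀ i j, 0 ≤ ⟪x i, x j⟫)
    (y : Fin n → ℝ) (hy : ∀ i, 0 < y i)
    (i : Fin n)
    (α : Fin n → ℝ) (hα : ∀ j, 0 ≤ α j)
    (w : EuclideanSpace ℝ (Fin d))
    (hw : w = (1 / (lam * n)) • ∑ j, α j • x j - (1 / lam) • ψ)
    (aplus : ℝ)
    (haplus : aplus = 1 / 2 *
      (Real.sqrt ((α i - lam * n / ‖x i‖ ^ 2 * ⟪x i, w⟫) ^ 2 +
          4 * lam * n * y i / ‖x i‖ ^ 2)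
        + α i - lam * n / ‖x i‖ ^ 2 * ⟪x i, w⟫))
    (β : ℝ)
    (hβ : β = 1 / (2 * ‖x i‖ ^ 2) *
      (n * ⟪ψ, x i⟫ +
        Real.sqrt ((n * ⟪ψ, x i⟫) ^ 2 + 4 * lam * n * y i * ‖x i‖ ^ 2))) :
    aplus ≤ β := by
  have hx0 : ‖x i‖ ≠ 0 := norm_ne_zero_iff.mpr (hx i)
  have hN : 0 < ‖x i‖ ^ 2 := by positivity
  have hn' : (0 : ℝ) < n := Nat.cast_pos.mpr hn
  have hinner : lam * n * ⟪x i, w⟫ = ∑ j, α j * ⟪x i, x j⟫ - n * ⟪ψ, x i⟫ := by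
    rw [hw, inner_sub_right, inner_smul_right, inner_smul_right, inner_sum,
      real_inner_comm (x i) ψ]
    simp only [inner_smul_right]
    field_simp
  have hsum : α i * ‖x i‖ ^ 2 ≤ ∑ j, α j * ⟪x i, x j⟫ := by
    rw [← real_inner_self_eq_norm_sq]
    exact Finset.single_le_sum (f := fun j => α j * ⟪x i, x j⟫)
      (fun j _ => mul_nonneg (hα j) (hxx i j)) (Finset.mem_univ i)
  have ht : α i - lam * n / ‖x i‖ ^ 2 * ⟪x i, w⟫ ≤ n * ⟪ψ, x i⟫ / ‖x i‖ ^ 2 := by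
    rw [div_mul_eq_mul_div, hinner, sub_le_iff_le_add, ← add_div, le_div_iff₀ hN]
    linarith
  have hc : 0 ≤ 4 * lam * n * y i / ‖x i‖ ^ 2 := by
    have := hy i
    positivity
  have hsqrt : √((n * ⟪ψ, x i⟫) ^ 2 + 4 * lam * n * y i * ‖x i‖ ^ 2) =
      ‖x i‖ ^ 2 * √((n * ⟪ψ, x i⟫ / ‖x i‖ ^ 2) ^ 2 + 4 * lam * n * y i / ‖x i‖ ^ 2) := by
    rw [← Real.sqrt_sq hN.le, ← Real.sqrt_mul (sq_nonneg _), Real.sqrt_sq hN.le]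
    congr 1
    field_simp
  have hβ' : β = 1 / 2 * (√((n * ⟪ψ, x i⟫ / ‖x i‖ ^ 2) ^ 2 +
      4 * lam * n * y i / ‖x i‖ ^ 2) + n * ⟪ψ, x i⟫ / ‖x i‖ ^ 2) := by
    rw [hβ, hsqrt]
    generalize √((n * ⟪ψ, x i⟫ / ‖x i‖ ^ 2) ^ 2 + 4 * lam * n * y i / ‖x i‖ ^ 2) = r
    field_simp
    ring
  rw [haplus, hβ', add_sub_assoc]
  exact mul_le_mul_of_nonneg_left (monotone_sqrt_sq_add_add_self hc ht) (by norm_num)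
end

section
/- Let λ > 0, n a positive integer, ψ, x_1, …, x_n ∈ ℝ^d, y_1, …, y_n > 0, κ ∈ (0, ∞)^n, and suppose χ := (1/n)·∑_{i=1}^n κ_i·x_i ≠ 0. Define the one-dimensional function D(ᾱ) = (1/n)·∑_{i=1}^n ( y_i + y_i·log(κ_i·ᾱ/y_i) ) − (λ/2)·‖ (ᾱ/(λn))·∑_{i=1}^n κ_i·x_i − ψ/λ ‖² for ᾱ > 0. Then D is concave on (0, ∞) and attains its maximum at the unique point ᾱ* = ( ψᵀχ + √( (ψᵀχ)² + 4λ·‖χ‖²·(1/n)·∑_{i=1}^n y_i ) ) / ( 2‖χ‖² ), which is the unique positive root of ‖χ‖²·ᾱ² − (ψᵀχ)·ᾱ − (λ/n)·∑_{i=1}^n y_i = 0. -/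
open Real Set Finset
open scoped RealInnerProductSpace

/-- A logarithm plus a concave quadratic is concave on the positive half-line. -/
lemma concaveOn_log_add_quadratic {S q : ℝ} (hS : 0 ≤ S) (hq : 0 ≤ q) (C p : ℝ) :
    ConcaveOn ℝ (Ioi 0) fun a => C + S * Real.log a + (p * a - q * a ^ 2 / 2) := by
  have hlog : ConcaveOn ℝ (Ioi 0) fun a => S * Real.log a :=
    strictConcaveOn_log_Ioi.concaveOn.smul hS
  have hquad : ConcaveOn ℝ (Ioi 0) fun a : ℝ => C + (p * a - q * a ^ 2 / 2) := by
    refine ⟨convex_Ioi 0, fun a _ b _ s t hs ht hst => ?_⟩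
    obtain rfl : t = 1 - s := by linarith
    simp only [smul_eq_mul]
    have : 0 ≤ q * (s * (1 - s)) * (a - b) ^ 2 := by positivity
    linarith
  refine (hlog.add hquad).congr fun a _ => ?_
  simp only [Pi.add_apply]
  ring

/-- Quadratic decay of `C + S log a + p a - q a² / 2` around a critical point `r`. -/
lemma log_add_quadratic_le_sub_sq {S q p r a : ℝ} (C : ℝ) (hS : 0 ≤ S) (hr : 0 < r)
    (hroot : q * r ^ 2 - p * r = S) (ha : 0 < a) :
    C + S * Real.log a + (p * a - q * a ^ 2 / 2) ≤
      C + S * Real.log r + (p * r - q * r ^ 2 / 2) - q / 2 * (a - r) ^ 2 := by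
  have h1 : Real.log a - Real.log r ≤ a / r - 1 := by
    rw [← Real.log_div ha.ne' hr.ne']
    exact Real.log_le_sub_one_of_pos (div_pos ha hr)
  have h2 : S * (a / r - 1) = (q * r - p) * (a - r) := by
    rw [← hroot]
    field_simp
  have h3 := mul_le_mul_of_nonneg_left h1 hS
  rw [h2] at h3
  linarith

/-- The larger root of `q a² - p a - c` with `q, c > 0` is positive and is a root. -/
lemma quadratic_larger_root_pos_and_eq_zero {q c : ℝ} (p : ℝ) (hq : 0 < q) (hc : 0 < c) {r : ℝ}
    (hr : r = (p + √(p ^ 2 + 4 * q * c)) / (2 * q)) :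
    0 < r ∧ q * r ^ 2 - p * r - c = 0 := by
  have hqc : 0 < q * c := mul_pos hq hc
  have hsq : √(p ^ 2 + 4 * q * c) ^ 2 = p ^ 2 + 4 * q * c :=
    Real.sq_sqrt (by nlinarith [sq_nonneg p])
  have hlt : |p| < √(p ^ 2 + 4 * q * c) := Real.lt_sqrt_of_sq_lt (by rw [sq_abs]; linarith)
  refine ⟨hr ▸ div_pos (by linarith [neg_abs_le p]) (by positivity), ?_⟩
  have h2 : 2 * q * r = p + √(p ^ 2 + 4 * q * c) := by
    rw [hr]
    field_simp
  have h3 : 4 * q * (q * r ^ 2 - p * r - c) = 0 := by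
    linear_combination (2 * q * r - p + √(p ^ 2 + 4 * q * c)) * h2 + hsq
  exact (mul_eq_zero.mp h3).resolve_left (by positivity)

/-- `q a² - p a - c` with `q, c > 0` has at most one positive root. -/
lemma quadratic_pos_root_unique {q p c a r : ℝ} (hq : 0 < q) (hc : 0 < c) (ha : 0 < a) (hr : 0 < r)
    (hra : q * a ^ 2 - p * a - c = 0) (hrr : q * r ^ 2 - p * r - c = 0) : a = r := by
  have h : (a - r) * (q * a * r + c) = 0 := by linear_combination r * hra - a * hrr
  have hpos : 0 < q * a * r + c := by positivity
  exact sub_eq_zero.mp ((mul_eq_zero.mp h).resolve_right hpos.ne')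

/-- Proposition 8, optimal rescaling of the heuristic initialization:
the one-dimensional restricted dual `D(ᾱ)` is concave on `(0, ∞)` and attains its
maximum at the unique point `ᾱ*` given in closed form, the unique positive root of
`‖χ‖²ᾱ² − (ψᵀχ)ᾱ − (λ/n)∑y_i = 0`, where `χ = (1/n)∑κ_i x_i`. -/
theorem dual_initial_guess_rescale
    (d n : ℕ) (hn : 0 < n) (lam : ℝ) (hlam : 0 < lam)
    (ψ : EuclideanSpace ℝ (Fin d)) (x : Fin n → EuclideanSpace ℝ (Fin d))
    (y κ : Fin n → ℝ) (hy : ∀ i, 0 < y i) (hκ : ∀ i, 0 < κ i)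
    (χ : EuclideanSpace ℝ (Fin d)) (hχdef : χ = (1 / (n : ℝ)) • ∑ i, κ i • x i)
    (hχ : χ ≠ 0)
    (Dbar : ℝ → ℝ)
    (hDbar : Dbar = fun a => (1 / (n : ℝ)) * ∑ i, (y i + y i * Real.log (κ i * a / y i))
        - lam / 2 * ‖(a / (lam * n)) • ∑ i, κ i • x i - (1 / lam) • ψ‖ ^ 2)
    (abar : ℝ)
    (habar : abar = (⟪ψ, χ⟫ +
        Real.sqrt (⟪ψ, χ⟫ ^ 2 + 4 * lam * ‖χ‖ ^ 2 * ((1 / (n : ℝ)) * ∑ i, y i))) /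
      (2 * ‖χ‖ ^ 2)) :
    ConcaveOn ℝ (Ioi 0) Dbar ∧
    abar ∈ Ioi (0:ℝ) ∧
    (∀ a ∈ Ioi (0:ℝ), Dbar a ≤ Dbar abar) ∧
    (∀ a ∈ Ioi (0:ℝ), (∀ b ∈ Ioi (0:ℝ), Dbar b ≤ Dbar a) → a = abar) ∧
    (‖χ‖ ^ 2 * abar ^ 2 - ⟪ψ, χ⟫ * abar - lam / n * ∑ i, y i = 0) ∧
    (∀ a ∈ Ioi (0:ℝ), ‖χ‖ ^ 2 * a ^ 2 - ⟪ψ, χ⟫ * a - lam / n * ∑ i, y i = 0 →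
      a = abar) := by
  have hn' : (0 : ℝ) < n := Nat.cast_pos.mpr hn
  have : Nonempty (Fin n) := ⟨⟨0, hn⟩⟩
  have hsum : 0 < ∑ i, y i := Finset.sum_pos (fun i _ => hy i) Finset.univ_nonempty
  set S : ℝ := (1 / (n : ℝ)) * ∑ i, y i with hSdef
  have hS : 0 < S := by positivity
  have hq : 0 < ‖χ‖ ^ 2 := by positivity
  have hlamS : lam / n * ∑ i, y i = lam * S := by rw [hSdef]; ring
  rw [hlamS]
  have hc : 0 < lam * S := mul_pos hlam hS
  obtain ⟨hpos, hroot⟩ := quadratic_larger_root_pos_and_eq_zero ⟪ψ, χ⟫ hq hc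
    (r := abar) (by rw [habar]; ring_nf)
  have hform : ∃ C : ℝ, ∀ a ∈ Ioi (0 : ℝ), Dbar a =
      C + S * Real.log a + (⟪ψ, χ⟫ / lam * a - ‖χ‖ ^ 2 / lam * a ^ 2 / 2) := by
    refine ⟨(1 / (n : ℝ)) * ∑ i, (y i + y i * Real.log (κ i / y i)) - ‖ψ‖ ^ 2 / (2 * lam),
      fun a ha => ?_⟩
    have ha : 0 < a := ha
    have hlogs : ∑ i, (y i + y i * Real.log (κ i * a / y i)) =
        ∑ i, (y i + y i * Real.log (κ i / y i)) + (∑ i, y i) * Real.log a := by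
      rw [Finset.sum_mul, ← Finset.sum_add_distrib]
      refine Finset.sum_congr rfl fun i _ => ?_
      rw [mul_div_right_comm, Real.log_mul (div_pos (hκ i) (hy i)).ne' ha.ne']
      ring
    have hvec : (a / (lam * n)) • ∑ i, κ i • x i - (1 / lam) • ψ = (1 / lam) • (a • χ - ψ) := by
      rw [hχdef, smul_sub, smul_smul, smul_smul]
      congr 2
      field_simp
    have hnorm : ‖(a / (lam * n)) • ∑ i, κ i • x i - (1 / lam) • ψ‖ ^ 2 =
        (1 / lam) ^ 2 * (a ^ 2 * ‖χ‖ ^ 2 - 2 * a * ⟪ψ, χ⟫ + ‖ψ‖ ^ 2) := by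
      rw [hvec, norm_smul, mul_pow, norm_sub_sq_real, real_inner_smul_left, real_inner_comm,
        norm_smul, mul_pow, Real.norm_eq_abs, Real.norm_eq_abs, sq_abs, sq_abs]
      ring
    rw [hDbar]
    simp only
    rw [hlogs, hnorm, hSdef]
    field_simp
    ring
  obtain ⟨C, hC⟩ := hform
  have hdecay : ∀ a ∈ Ioi (0 : ℝ), Dbar a ≤ Dbar abar - ‖χ‖ ^ 2 / lam / 2 * (a - abar) ^ 2 := by
    intro a ha
    rw [hC a ha, hC abar hpos]
    refine log_add_quadratic_le_sub_sq C hS.le hpos ?_ ha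
    field_simp
    linarith
  have hcoef : 0 < ‖χ‖ ^ 2 / lam / 2 := by positivity
  refine ⟨?_, hpos, fun a ha => ?_, fun a ha hmax => ?_, hroot, fun a ha hra => ?_⟩
  · exact (concaveOn_log_add_quadratic hS.le (div_pos hq hlam).le C _).congr
      fun a ha => (hC a ha).symm
  · exact (hdecay a ha).trans (sub_le_self _ (by positivity))
  · have h := (hmax abar hpos).trans (hdecay a ha)
    have hsq : (a - abar) ^ 2 = 0 :=
      le_antisymm (nonpos_of_mul_nonpos_right (by linarith) hcoef) (sq_nonneg _)
    exact sub_eq_zero.mp (pow_eq_zero_iff two_ne_zero |>.mp hsq)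
  · exact quadratic_pos_root_unique hq hc ha hpos hra hroot
end
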